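/- arXiv:1409.6215 — 3 statements merged into one kernel-verified Lean document; each statement's English description precedes it below -/
import Mathlib

section
/- Let F = {(f_1, g_1), …, (f_k, g_k)} (k ≥ 1) be a system of min-plus polynomials in n variables over ℝ∞, each of degree at most d (d ≥ 1), and set N = 2(n+2)²·k·(4d)^{min(n,k)+2}. Then F has a root in ℝ∞^n if and only if the non-homogeneous Macaulay min-plus linear system Ml_N ⊙ (0, y) = Mr_N ⊙ (0, y) of F has a solution. -/
open scoped Classical

/-- Exponent vectors in `n` variables. -/
abbrev Exp (n : ℕ) : Type := Fin n → ℕ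

/-- The total degree `|I|` of an exponent vector. -/
def expDeg {n : ℕ} (I : Exp n) : ℕ := ∑ j, I j

/-- A tropical polynomial: a finite nonempty support of exponent vectors
together with real coefficients. -/
structure TropPoly (n : ℕ) where
  supp : Finset (Exp n)
  supp_nonempty : supp.Nonempty
  coeff : Exp n → ℝ

/-- The degree of a tropical polynomial. -/
def TropPoly.deg {n : ℕ} (f : TropPoly n) : ℕ := f.supp.sup expDeg

/-- Value of the monomial of `f` with exponent `I` at a point of `ℝ^n`. -/
def TropPoly.mono {n : ℕ} (f : TropPoly n) (I : Exp n) (a : Fin n → ℝ) : ℝ :=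
  f.coeff I + ∑ j, (I j : ℝ) * a j

/-- Value of a tropical polynomial at a point of `ℝ^n`. -/
def TropPoly.eval {n : ℕ} (f : TropPoly n) (a : Fin n → ℝ) : ℝ :=
  f.supp.inf' f.supp_nonempty (fun I => f.mono I a)

/-- A point of `ℝ^n` is a root if the minimum is attained at two distinct monomials. -/
def TropPoly.IsRoot {n : ℕ} (f : TropPoly n) (a : Fin n → ℝ) : Prop :=
  ∃ I ∈ f.supp, ∃ J ∈ f.supp, I ≠ J ∧
    f.mono I a = f.eval a ∧ f.mono J a = f.eval a

/-- Value of the monomial of `f` with exponent `I` at a point of `ℝ∞^n`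
(with the convention `0 • ⊤ = 0`). -/
noncomputable def TropPoly.monoT {n : ℕ} (f : TropPoly n) (I : Exp n)
    (a : Fin n → WithTop ℝ) : WithTop ℝ :=
  (f.coeff I : WithTop ℝ) + ∑ j, (I j) • a j

/-- Value of a tropical polynomial at a point of `ℝ∞^n`. -/
noncomputable def TropPoly.evalT {n : ℕ} (f : TropPoly n) (a : Fin n → WithTop ℝ) : WithTop ℝ :=
  f.supp.inf (fun I => f.monoT I a)

/-- A point of `ℝ∞^n` is a root if the minimum is `+∞` or is attained at two
distinct monomials. -/
noncomputable def TropPoly.IsRootT {n : ℕ} (f : TropPoly n) (a : Fin n → WithTop ℝ) : Prop :=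
  f.evalT a = ⊤ ∨ ∃ I ∈ f.supp, ∃ J ∈ f.supp, I ≠ J ∧
    f.monoT I a = f.evalT a ∧ f.monoT J a = f.evalT a

/-- The coefficient of the monomial `x^I` in `x^J ⊙ f`, which is `+∞`
unless `I - J` belongs to the support of `f`. -/
noncomputable def shiftCoeff {n : ℕ} (f : TropPoly n) (J I : Exp n) : WithTop ℝ :=
  if J ≤ I ∧ I - J ∈ f.supp then (f.coeff (I - J) : WithTop ℝ) else ⊤

/-- The entry `c_{f}(I-J) + y_I` of the Macaulay system. -/
noncomputable def macVal {n : ℕ} (f : TropPoly n) (J : Exp n)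
    (y : Exp n → WithTop ℝ) (I : Exp n) : WithTop ℝ :=
  shiftCoeff f J I + y I
/-- The finite set of all exponent vectors of total degree at most `N`. -/
noncomputable def degLE (n N : ℕ) : Finset (Exp n) :=
  (Finset.Iic (fun _ => N : Exp n)).filter (fun I => expDeg I ≤ N)

lemma mem_degLE {n N : ℕ} (I : Exp n) : I ∈ degLE n N ↔ expDeg I ≤ N := by
  unfold degLE
  simp only [Finset.mem_filter, Finset.mem_Iic, and_iff_right_iff_imp]
  intro h
  intro j
  calc I j ≤ ∑ i, I i := Finset.single_le_sum (fun i _ => Nat.zero_le _) (Finset.mem_univ j)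
  _ ≤ N := h

/-- The minimum over all `I` with `|I| ≤ N` of `c_f(I-J) + y_I`. -/
noncomputable def macMinLE {n : ℕ} (f : TropPoly n) (J : Exp n)
    (y : Exp n → WithTop ℝ) (N : ℕ) : WithTop ℝ :=
  (degLE n N).inf (fun I => macVal f J y I)

/-- `y` is a solution of the non-homogeneous Macaulay min-plus linear system
`Ml_N ⊙ (0,y) = Mr_N ⊙ (0,y)` of the min-plus system `F` over `ℝ∞` (the coordinate at the
zero exponent vector being fixed to `0`). -/
noncomputable def IsMPMacaulaySolT {n k : ℕ} (F : Fin k → TropPoly n × TropPoly n) (N : ℕ)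
    (y : Exp n → WithTop ℝ) : Prop :=
  ∀ j : Fin k, ∀ J : Exp n, expDeg J + max (F j).1.deg (F j).2.deg ≤ N →
    macMinLE (F j).1 J y N = macMinLE (F j).2 J y N


/-! ### Auxiliary material -/

/-- Lifted points. -/
abbrev LSp (n : ℕ) : Type := (Fin n → ℝ) × ℝ

/-- The lifted point of an exponent vector. -/
def lpt {n : ℕ} (m : Exp n → ℝ) (u : Exp n) : LSp n := (fun j => (u j : ℝ), m u)

/-- The linear functional attached to a point. -/
def ell {n : ℕ} (a : Fin n → ℝ) (X : LSp n) : ℝ := X.2 + ∑ j, a j * X.1 j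

/-- The objective. -/
def gobj {n : ℕ} (M : ℝ) (θ : ℝ → ℝ) (y : ℝ) (I : Exp n) (T : LSp n) : ℝ :=
  y + M * T.2 - ∑ j, θ ((I j : ℝ) - M * T.1 j)

lemma ell_add {n : ℕ} (a : Fin n → ℝ) (X Z : LSp n) : ell a (X + Z) = ell a X + ell a Z := by
  simp only [ell, Prod.snd_add, Prod.fst_add, Pi.add_apply, mul_add, Finset.sum_add_distrib]
  ring

lemma ell_smul {n : ℕ} (a : Fin n → ℝ) (t : ℝ) (X : LSp n) : ell a (t • X) = t * ell a X := by
  simp only [ell, Prod.smul_snd, Prod.smul_fst, Pi.smul_apply, smul_eq_mul, mul_add,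
    Finset.mul_sum]
  congr 1
  exact Finset.sum_congr rfl fun j _ => by ring

lemma ell_sub {n : ℕ} (a : Fin n → ℝ) (X Z : LSp n) : ell a (X - Z) = ell a X - ell a Z := by
  have := ell_add a (X - Z) Z
  rw [sub_add_cancel] at this
  linarith

lemma ell_sum {n : ℕ} {ι : Type*} (a : Fin n → ℝ) (s : Finset ι) (X : ι → LSp n) :
    ell a (∑ i ∈ s, X i) = ∑ i ∈ s, ell a (X i) := by
  induction s using Finset.induction_on with
  | empty => simp [ell]
  | insert i s hi ih => rw [Finset.sum_insert hi, Finset.sum_insert hi, ell_add, ih]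

lemma gobj_deriv {n : ℕ} (M : ℝ) (θ θ' : ℝ → ℝ) (hθ : ∀ x, HasDerivAt θ (θ' x) x)
    (y : ℝ) (I : Exp n) (T D : LSp n) :
    HasDerivAt (fun t : ℝ => gobj M θ y I (T + t • D))
      (M * ell (fun j => θ' ((I j : ℝ) - M * T.1 j)) D) 0 := by
  have h1 : ∀ j, HasDerivAt (fun t : ℝ => θ ((I j : ℝ) - M * (T.1 j + t * D.1 j)))
      (θ' ((I j : ℝ) - M * T.1 j) * (-(M * D.1 j))) 0 := by
    intro j
    have hin : HasDerivAt (fun t : ℝ => (I j : ℝ) - M * (T.1 j + t * D.1 j)) (-(M * D.1 j)) 0 := by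
      have := (((hasDerivAt_id (0 : ℝ)).mul_const (D.1 j)).const_add (T.1 j)).const_mul M
      simpa using this.const_sub (I j : ℝ)
    have ho := hθ ((I j : ℝ) - M * (T.1 j + 0 * D.1 j))
    have := HasDerivAt.comp (0 : ℝ) ho hin
    simpa [Function.comp_def] using this
  have h2 := HasDerivAt.fun_sum (u := Finset.univ) (fun j _ => h1 j)
  have h3 : HasDerivAt (fun t : ℝ => y + M * (T.2 + t * D.2)) (M * D.2) 0 := by
    have := ((((hasDerivAt_id (0 : ℝ)).mul_const D.2).const_add T.2).const_mul M).const_add y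
    simpa using this
  have h4 := h3.sub h2
  have e : M * ell (fun j => θ' ((I j : ℝ) - M * T.1 j)) D
      = M * D.2 - ∑ j, θ' ((I j : ℝ) - M * T.1 j) * (-(M * D.1 j)) := by
    simp only [ell, mul_add, Finset.mul_sum]
    rw [sub_eq_add_neg, ← Finset.sum_neg_distrib]
    congr 1
    exact Finset.sum_congr rfl fun j _ => by ring
  rw [e]
  exact h4

lemma gobj_first_order {n : ℕ} (M : ℝ) (hM : 0 < M) (θ θ' : ℝ → ℝ)
    (hθ : ∀ x, HasDerivAt θ (θ' x) x) (y : ℝ) (I : Exp n) (T D : LSp n)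
    (h : ∀ t : ℝ, 0 ≤ t → t ≤ 1 → gobj M θ y I T ≤ gobj M θ y I (T + t • D)) :
    0 ≤ ell (fun j => θ' ((I j : ℝ) - M * T.1 j)) D := by
  have hd := gobj_deriv M θ θ' hθ y I T D
  by_contra hneg
  push Not at hneg
  have hlt := mul_neg_of_pos_of_neg hM hneg
  have hs := (hasDerivAt_iff_tendsto_slope.1 hd)
  have hs' := hs.mono_left (nhdsWithin_mono 0 (fun x (hx : x ∈ Set.Ioi (0:ℝ)) => ne_of_gt hx))
  have he := hs'.eventually (gt_mem_nhds hlt)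
  have h01 : ∀ᶠ t in nhdsWithin (0:ℝ) (Set.Ioi 0), t ∈ Set.Ioo (0:ℝ) 1 :=
    Ioo_mem_nhdsGT one_pos
  obtain ⟨t, ht1, ht2⟩ := (he.and h01).exists
  rw [slope_def_field] at ht1
  have := h t ht2.1.le ht2.2.le
  simp only [zero_smul, add_zero, sub_zero] at ht1
  rw [div_neg_iff] at ht1
  rcases ht1 with ⟨_, h'⟩ | ⟨h', _⟩
  · linarith [ht2.1]
  · linarith

lemma gobj_cont {n : ℕ} (M : ℝ) (θ : ℝ → ℝ) (hθ : Continuous θ) (y : ℝ) (I : Exp n) :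
    Continuous (fun T : LSp n => gobj M θ y I T) := by
  unfold gobj
  fun_prop

/-- Caratheodory: a point of the hull minimizing a linear functional. -/
lemma caratheodory_vertex {n : ℕ} (P : Finset (Exp n)) (m : Exp n → ℝ) (a : Fin n → ℝ)
    (W : LSp n) (hW : W ∈ convexHull ℝ (Set.image (lpt m) (P : Set (Exp n))))
    (hmin : ∀ u ∈ P, ell a W ≤ ell a (lpt m u)) :
    ∃ v ∈ P, ell a (lpt m v) = ell a W ∧ ∀ X ∈ convexHull ℝ (Set.image (lpt m) (P : Set (Exp n))),
      W + ((n : ℝ) + 2)⁻¹ • (X - lpt m v) ∈ convexHull ℝ (Set.image (lpt m) (P : Set (Exp n))) := by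
  obtain ⟨ι, hι, z, w, hz, hind, hw, hsum, hbar⟩ := eq_pos_convex_span_of_mem_convexHull hW
  have hcard : Fintype.card ι ≤ n + 2 := by
    have := hind.card_le_finrank_succ
    have h3 : Module.finrank ℝ (LSp n) = n + 1 := by simp [LSp]
    have h2 : Module.finrank ℝ (vectorSpan ℝ (Set.range z)) ≤ n + 1 :=
      (Submodule.finrank_le (vectorSpan ℝ (Set.range z))).trans h3.le
    exact this.trans (Nat.succ_le_succ h2)
  have hMpos : (0:ℝ) < (n:ℝ) + 2 := by positivity
  have hzmem : ∀ t, ∃ v ∈ P, lpt m v = z t := fun t => by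
    obtain ⟨v, hv, e⟩ := hz ⟨t, rfl⟩
    exact ⟨v, hv, e⟩
  have hge : ∀ t, ell a W ≤ ell a (z t) := fun t => by
    obtain ⟨v, hv, e⟩ := hzmem t
    rw [← e]; exact hmin v hv
  have heq : ∀ t, ell a (z t) = ell a W := by
    have h0 : ∑ t, w t * (ell a (z t) - ell a W) = 0 := by
      have hb : ∑ t, w t * ell a (z t) = ell a W := by
        rw [← hbar, ell_sum]
        simp only [ell_smul]
      simp only [mul_sub, Finset.sum_sub_distrib, ← Finset.sum_mul, hsum, hb]
      ring
    have h1 := (Finset.sum_eq_zero_iff_of_nonneg (fun t _ =>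
      mul_nonneg (hw t).le (sub_nonneg.2 (hge t)))).1 h0
    intro t
    have := h1 t (Finset.mem_univ t)
    rcases mul_eq_zero.1 this with h | h
    · exact absurd h (hw t).ne'
    · linarith
  have hbig : ∃ t, ((n:ℝ) + 2)⁻¹ ≤ w t := by
    by_contra hcon
    push Not at hcon
    have hne : (Finset.univ : Finset ι).Nonempty := by
      by_contra hne
      rw [Finset.not_nonempty_iff_eq_empty] at hne
      rw [hne] at hsum
      simp at hsum
    have h1 : ∑ t, w t < ∑ _t : ι, ((n:ℝ) + 2)⁻¹ :=
      Finset.sum_lt_sum_of_nonempty hne (fun t _ => hcon t)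
    rw [hsum, Finset.sum_const, Finset.card_univ, nsmul_eq_mul] at h1
    have h2 : (Fintype.card ι : ℝ) ≤ (n:ℝ) + 2 := by exact_mod_cast hcard
    have h3 : (Fintype.card ι : ℝ) * ((n:ℝ) + 2)⁻¹ ≤ ((n:ℝ) + 2) * ((n:ℝ) + 2)⁻¹ :=
      mul_le_mul_of_nonneg_right h2 (by positivity)
    rw [mul_inv_cancel₀ hMpos.ne'] at h3
    linarith
  obtain ⟨t, ht⟩ := hbig
  obtain ⟨v, hv, e⟩ := hzmem t
  refine ⟨v, hv, by rw [e, heq], fun X hX => ?_⟩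
  rw [e]
  set q := ((n:ℝ) + 2)⁻¹ with hq
  have hq0 : 0 < q := inv_pos.2 hMpos
  have hconv := convex_convexHull ℝ (Set.image (lpt m) (P : Set (Exp n)))
  have key : W + q • (X - z t) = ∑ o : Option ι,
      (Option.elim o q (fun s => if s = t then w s - q else w s)) •
        (Option.elim o X z) := by
    rw [Fintype.sum_option]
    simp only [Option.elim]
    have : ∀ s, (if s = t then w s - q else w s) • z s
        = w s • z s - (if s = t then q • z t else 0) := by
      intro s
      split_ifs with h
      · rw [h, sub_smul]
      · rw [sub_zero]
    simp only [this, Finset.sum_sub_distrib, hbar, Finset.sum_ite_eq', Finset.mem_univ, if_true]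
    rw [smul_sub]
    abel
  rw [key]
  refine hconv.sum_mem ?_ ?_ ?_
  · rintro (_ | s) _
    · exact hq0.le
    · simp only [Option.elim]
      split_ifs with h
      · rw [h]; linarith
      · exact (hw s).le
  · rw [Fintype.sum_option]
    simp only [Option.elim]
    have : ∀ s, (if s = t then w s - q else w s) = w s - (if s = t then q else 0) := by
      intro s
      split_ifs <;> simp
    simp only [this, Finset.sum_sub_distrib, hsum, Finset.sum_ite_eq', Finset.mem_univ, if_true]
    ring
  · rintro (_ | s) _
    · exact hX
    · exact subset_convexHull ℝ _ (hz ⟨s, rfl⟩)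

theorem core_opt {n k : ℕ} (P : Fin k → Finset (Exp n)) (hP : ∀ i, (P i).Nonempty)
    (m : Fin k → Exp n → ℝ) (Y : Finset (Exp n)) (hY : Y.Nonempty) (yr : Exp n → ℝ)
    (θ θ' : ℝ → ℝ) (hθ : ∀ x, HasDerivAt θ (θ' x) x) (M : ℝ) (hM : M = (n:ℝ) + 2) :
    ∃ I ∈ Y, ∃ W : Fin k → LSp n,
      (∀ i, W i ∈ convexHull ℝ (Set.image (lpt (m i)) (P i : Set (Exp n)))) ∧
      (∀ Q ∈ Y, ∀ W' : Fin k → LSp n,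
        (∀ i, W' i ∈ convexHull ℝ (Set.image (lpt (m i)) (P i : Set (Exp n)))) →
        gobj M θ (yr I) I (∑ i, W i) ≤ gobj M θ (yr Q) Q (∑ i, W' i)) ∧
      ∀ a : Fin n → ℝ, (a = fun j => θ' ((I j : ℝ) - M * (∑ i, W i).1 j)) →
      ∀ i, ∃ v ∈ P i, (∀ u ∈ P i, ell a (lpt (m i) v) ≤ ell a (lpt (m i) u)) ∧
        ∀ u ∈ P i, ∀ Q ∈ Y, Q + v = I + u →
          m i v + yr I ≤ m i u + yr Q ∧
          (m i u + yr Q ≤ m i v + yr I → ell a (lpt (m i) u) ≤ ell a (lpt (m i) v)) := by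
  have hMpos : 0 < M := by rw [hM]; positivity
  set H : Fin k → Set (LSp n) := fun i => convexHull ℝ (Set.image (lpt (m i)) (P i : Set (Exp n))) with hH
  have hcomp : IsCompact (Set.univ.pi H) := isCompact_univ_pi fun i =>
    ((P i).finite_toSet.image _).isCompact_convexHull ℝ
  have hne : (Set.univ.pi H).Nonempty := by
    choose p hp using hP
    exact ⟨fun i => lpt (m i) (p i), fun i _ => subset_convexHull ℝ _ ⟨p i, hp i, rfl⟩⟩
  have hθc : Continuous θ := continuous_iff_continuousAt.2 fun x => (hθ x).continuousAt
  have hex : ∀ Q : Exp n, ∃ W ∈ Set.univ.pi H, ∀ W' ∈ Set.univ.pi H,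
      gobj M θ (yr Q) Q (∑ i, W i) ≤ gobj M θ (yr Q) Q (∑ i, W' i) := by
    intro Q
    have hc : Continuous (fun W : Fin k → LSp n => gobj M θ (yr Q) Q (∑ i, W i)) :=
      (gobj_cont M θ hθc (yr Q) Q).comp (by fun_prop)
    obtain ⟨W, hW, hWm⟩ := hcomp.exists_isMinOn hne hc.continuousOn
    exact ⟨W, hW, fun W' hW' => hWm hW'⟩
  choose WW hWW hWWm using hex
  obtain ⟨I, hI, hIm⟩ := Y.exists_min_image (fun Q => gobj M θ (yr Q) Q (∑ i, WW Q i)) hY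
  have hopt : ∀ Q ∈ Y, ∀ W' : Fin k → LSp n, (∀ i, W' i ∈ H i) →
        gobj M θ (yr I) I (∑ i, WW I i) ≤ gobj M θ (yr Q) Q (∑ i, W' i) :=
    fun Q hQ W' hW' => (hIm Q hQ).trans (hWWm Q W' fun i _ => hW' i)
  have hsumupd : ∀ (W : Fin k → LSp n) (i : Fin k) (D : LSp n),
      ∑ s, (W + (Pi.single i D : Fin k → LSp n)) s = ∑ s, W s + D := by
    intro W i D
    simp only [Pi.add_apply, Finset.sum_add_distrib]
    congr 1
    rw [Finset.sum_eq_single i]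
    · simp
    · intro b _ hb; simp [hb]
    · simp
  have hmemupd : ∀ (W : Fin k → LSp n) (i : Fin k) (D : LSp n), (∀ s, W s ∈ H s) →
      W i + D ∈ H i → ∀ s, (W + (Pi.single i D : Fin k → LSp n)) s ∈ H s := by
    intro W i D hW hD s
    by_cases h : s = i
    · subst h; simpa using hD
    · simpa [h] using hW s
  have hfo : ∀ Q ∈ Y, ∀ W : Fin k → LSp n, (∀ i, W i ∈ H i) →
      gobj M θ (yr Q) Q (∑ i, W i) ≤ gobj M θ (yr I) I (∑ i, WW I i) →
      ∀ i, ∀ X ∈ H i, ell (fun j => θ' ((Q j : ℝ) - M * (∑ i, W i).1 j)) (W i) ≤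
        ell (fun j => θ' ((Q j : ℝ) - M * (∑ i, W i).1 j)) X := by
    intro Q hQ W hW hle i X hX
    have := gobj_first_order M hMpos θ θ' hθ (yr Q) Q (∑ i, W i) (X - W i) (by
      intro t ht0 ht1
      refine hle.trans ?_
      rw [← hsumupd]
      refine hopt Q hQ _ (hmemupd W i _ hW ?_)
      exact (convex_convexHull ℝ _).add_smul_sub_mem (hW i) hX ⟨ht0, ht1⟩)
    rw [ell_sub] at this
    linarith
  have hWI : ∀ i, WW I i ∈ H i := fun i => hWW I i (Set.mem_univ i)
  refine ⟨I, hI, WW I, hWI, hopt, ?_⟩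
  rintro a rfl i
  set W := WW I with hWdef
  set a : Fin n → ℝ := fun j => θ' ((I j : ℝ) - M * (∑ i, W i).1 j) with ha
  have hmin := hfo I hI W hWI le_rfl i
  have hmem : ∀ u ∈ P i, lpt (m i) u ∈ H i := fun u hu => subset_convexHull ℝ _ ⟨u, hu, rfl⟩
  obtain ⟨v, hv, hve, hvmove⟩ := caratheodory_vertex (P i) (m i) a (W i) (hWI i)
    (fun u hu => hmin _ (hmem u hu))
  refine ⟨v, hv, fun u hu => by rw [hve]; exact hmin _ (hmem u hu), ?_⟩
  intro u hu Q hQ hQv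
  have hmv := hvmove (lpt (m i) u) (hmem u hu)
  rw [← hM] at hmv
  set D : LSp n := M⁻¹ • (lpt (m i) u - lpt (m i) v) with hD
  have hW' := hmemupd W i D hWI hmv
  have hz : ∀ j, (Q j : ℝ) - M * (∑ s, (W + (Pi.single i D : Fin k → LSp n)) s).1 j
      = (I j : ℝ) - M * (∑ s, W s).1 j := by
    intro j
    rw [hsumupd]
    have h1 : (Q j : ℝ) + v j = I j + u j := by exact_mod_cast congrFun hQv j
    have h2 : M * D.1 j = u j - v j := by
      simp only [hD, Prod.smul_fst, Pi.smul_apply, Prod.fst_sub, Pi.sub_apply, lpt, smul_eq_mul]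
      rw [← mul_assoc, mul_inv_cancel₀ hMpos.ne', one_mul]
    simp only [Prod.fst_add, Pi.add_apply, mul_add, h2]
    linarith
  have hval : gobj M θ (yr Q) Q (∑ s, (W + (Pi.single i D : Fin k → LSp n)) s)
      = gobj M θ (yr I) I (∑ s, W s) + (yr Q + m i u) - (yr I + m i v) := by
    unfold gobj
    simp only [hz]
    rw [hsumupd]
    have h2 : M * D.2 = m i u - m i v := by
      simp only [hD, Prod.smul_snd, Prod.snd_sub, lpt, smul_eq_mul]
      rw [← mul_assoc, mul_inv_cancel₀ hMpos.ne', one_mul]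
    simp only [Prod.snd_add, mul_add, h2]
    ring
  constructor
  · have := hopt Q hQ _ hW'
    rw [hval] at this
    linarith
  · intro hle
    have := hfo Q hQ _ hW' (by rw [hval]; linarith) i (W i) (hWI i)
    simp only [hz] at this
    rw [← ha, Pi.add_apply, Pi.single_eq_same, ell_add, hD, ell_smul, ell_sub] at this
    have hneg : M⁻¹ * (ell a (lpt (m i) u) - ell a (lpt (m i) v)) ≤ 0 := by linarith
    have hMi : 0 < M⁻¹ := inv_pos.2 hMpos
    nlinarith

/-- The one-variable potential. -/
noncomputable def thetaF (L K s : ℝ) (z : ℝ) : ℝ :=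
  L * (z - s) - (L + K) / 2 * ((z - s) + Real.sqrt ((z - s) ^ 2 + 1))

/-- Its derivative. -/
noncomputable def thetaD (L K s : ℝ) (z : ℝ) : ℝ :=
  L - (L + K) / 2 * (1 + (z - s) / Real.sqrt ((z - s) ^ 2 + 1))

lemma thetaF_deriv (L K s z : ℝ) : HasDerivAt (thetaF L K s) (thetaD L K s z) z := by
  have hpos : 0 < (z - s) ^ 2 + 1 := by positivity
  have h0 : HasDerivAt (fun z : ℝ => z - s) 1 z := (hasDerivAt_id z).sub_const s
  have h1 : HasDerivAt (fun z : ℝ => (z - s) ^ 2 + 1) (2 * (z - s)) z := by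
    simpa using (h0.pow 2).add_const 1
  have h2 := h1.sqrt hpos.ne'
  have h3 := (h0.const_mul L).sub ((h0.add h2).const_mul ((L + K) / 2))
  have hs : 0 < Real.sqrt ((z - s) ^ 2 + 1) := Real.sqrt_pos.2 hpos
  have e : thetaD L K s z = L * 1 - (L + K) / 2 *
      (1 + 2 * (z - s) / (2 * Real.sqrt ((z - s) ^ 2 + 1))) := by
    unfold thetaD
    field_simp
  rw [e]
  exact h3

lemma thetaF_le (L K s z : ℝ) (h : 0 ≤ L + K) : thetaF L K s z ≤ -K * (z - s) := by
  unfold thetaF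
  have h1 : z - s ≤ Real.sqrt ((z - s) ^ 2 + 1) := Real.le_sqrt_of_sq_le (by linarith)
  nlinarith

lemma le_thetaF (L K s z : ℝ) (h : 0 ≤ L + K) (hz : z ≤ s) :
    L * (z - s) - (L + K) / 2 ≤ thetaF L K s z := by
  unfold thetaF
  have h1 : Real.sqrt ((z - s) ^ 2 + 1) ≤ 1 - (z - s) :=
    Real.sqrt_le_iff.2 ⟨by linarith, by nlinarith⟩
  nlinarith

lemma thetaD_ge (L K s z : ℝ) (h : 0 ≤ L + K) : -K ≤ thetaD L K s z := by
  unfold thetaD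
  have hpos : 0 < Real.sqrt ((z - s) ^ 2 + 1) := Real.sqrt_pos.2 (by positivity)
  have h1 : z - s ≤ Real.sqrt ((z - s) ^ 2 + 1) := Real.le_sqrt_of_sq_le (by linarith)
  have h2 : (z - s) / Real.sqrt ((z - s) ^ 2 + 1) ≤ 1 := (div_le_one hpos).2 h1
  nlinarith

lemma thetaD_ge_of_le (L K s z : ℝ) (h : 0 ≤ L + K) (hz : z ≤ s) :
    (L - K) / 2 ≤ thetaD L K s z := by
  unfold thetaD
  have h2 : (z - s) / Real.sqrt ((z - s) ^ 2 + 1) ≤ 0 :=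
    div_nonpos_of_nonpos_of_nonneg (by linarith) (Real.sqrt_nonneg _)
  nlinarith

/-- Bounds on the hull. -/
lemma hull_bounds {n d : ℕ} (P : Finset (Exp n)) (m : Exp n → ℝ)
    (hdeg : ∀ u ∈ P, expDeg u ≤ d) (W : LSp n)
    (hW : W ∈ convexHull ℝ (Set.image (lpt m) (P : Set (Exp n)))) :
    (∀ j, 0 ≤ W.1 j) ∧ ∑ j, W.1 j ≤ d := by
  have hc1 : Convex ℝ {X : LSp n | ∀ j, 0 ≤ X.1 j} := by
    intro X hX Z hZ a b ha hb _ j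
    simp only [Prod.fst_add, Prod.smul_fst, Pi.add_apply, Pi.smul_apply, smul_eq_mul]
    exact add_nonneg (mul_nonneg ha (hX j)) (mul_nonneg hb (hZ j))
  have hc2 : Convex ℝ {X : LSp n | ∑ j, X.1 j ≤ d} := by
    intro X hX Z hZ a b ha hb hab
    simp only [Set.mem_ofPred_eq, Prod.fst_add, Prod.smul_fst, Pi.add_apply, Pi.smul_apply,
      smul_eq_mul, Finset.sum_add_distrib, ← Finset.mul_sum] at *
    calc a * ∑ j, X.1 j + b * ∑ j, Z.1 j ≤ a * d + b * d :=
          add_le_add (mul_le_mul_of_nonneg_left hX ha) (mul_le_mul_of_nonneg_left hZ hb)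
      _ = d := by rw [← add_mul, hab, one_mul]
  have := convexHull_min (s := Set.image (lpt m) (P : Set (Exp n))) (by
    rintro _ ⟨u, hu, rfl⟩
    refine ⟨fun j => ?_, ?_⟩
    · simp [lpt]
    · have := hdeg u hu
      simp only [lpt, Set.mem_ofPred_eq]
      unfold expDeg at this
      exact_mod_cast this) (hc1.inter hc2) hW
  exact this

/-- Existence of a good level. -/
lemma good_level (n k : ℕ) (A : ℕ → Finset (Fin n)) (hA : Monotone A)
    (act : Fin k → ℕ → Prop) (inn : Fin k → ℕ → Prop)
    (h1 : ∀ i l l', l < l' → act i l → inn i l')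
    (h2 : ∀ i l l', A l' ⊆ A l → inn i l' → inn i l) :
    ∃ l ≤ min n k, ∀ i, act i l → inn i l := by
  by_contra hcon
  push Not at hcon
  have hk : min n k + 1 ≤ k := by
    choose f hf hf' using hcon
    have hinj : Function.Injective
        (fun l : Fin (min n k + 1) => f l (Nat.lt_succ_iff.1 l.2)) := by
      intro a b hab
      simp only at hab
      by_contra hne
      rcases lt_or_gt_of_ne hne with h | h
      · exact hf' b (Nat.lt_succ_iff.1 b.2) (hab ▸ h1 _ _ _ h (hf a (Nat.lt_succ_iff.1 a.2)))
      · exact hf' a (Nat.lt_succ_iff.1 a.2)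
          (hab.symm ▸ h1 _ _ _ h (hf b (Nat.lt_succ_iff.1 b.2)))
    simpa using Fintype.card_le_of_injective _ hinj
  have hn : min n k + 1 ≤ n := by
    have : ∀ l ≤ min n k, ∃ j, j ∈ A (l + 1) ∧ j ∉ A l := by
      intro l hl
      obtain ⟨i, hi, hi'⟩ := hcon l hl
      by_contra hno
      push Not at hno
      exact hi' (h2 i l (l + 1) (fun j hj => hno j hj) (h1 i l (l + 1) (Nat.lt_succ_self l) hi))
    choose f hf hf' using this
    have hinj : Function.Injective
        (fun l : Fin (min n k + 1) => f l (Nat.lt_succ_iff.1 l.2)) := by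
      intro a b hab
      simp only at hab
      by_contra hne
      rcases lt_or_gt_of_ne hne with h | h
      · exact hf' b (Nat.lt_succ_iff.1 b.2)
          (hab ▸ hA (show (a : ℕ) + 1 ≤ b from h) (hf a (Nat.lt_succ_iff.1 a.2)))
      · exact hf' a (Nat.lt_succ_iff.1 a.2)
          (hab.symm ▸ hA (show (b : ℕ) + 1 ≤ a from h) (hf b (Nat.lt_succ_iff.1 b.2)))
    simpa using Fintype.card_le_of_injective _ hinj
  rcases Nat.le_total n k with h | h
  · rw [min_eq_left h] at hn; omega
  · rw [min_eq_right h] at hk; omega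

/-- The point with coordinates outside `A` sent to infinity. -/
noncomputable def extT {n : ℕ} (A : Finset (Fin n)) (a : Fin n → ℝ) : Fin n → WithTop ℝ :=
  fun j => if j ∈ A then (a j : WithTop ℝ) else ⊤

lemma nsmul_top_ne {t : ℕ} (ht : t ≠ 0) : t • (⊤ : WithTop ℝ) = ⊤ := by
  obtain ⟨s, rfl⟩ := Nat.exists_eq_succ_of_ne_zero ht
  rw [Nat.succ_eq_add_one, succ_nsmul, WithTop.add_top]

lemma monoT_extT_of_sub {n : ℕ} (f : TropPoly n) (A : Finset (Fin n)) (a : Fin n → ℝ) (u : Exp n)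
    (hu : ∀ j, u j ≠ 0 → j ∈ A) :
    f.monoT u (extT A a) = ((ell a (lpt f.coeff u) : ℝ) : WithTop ℝ) := by
  have h : ∀ j, u j • extT A a j = ((a j * u j : ℝ) : WithTop ℝ) := by
    intro j
    by_cases h0 : u j = 0
    · simp [h0]
    · simp only [extT, hu j h0, if_true]
      rw [← WithTop.coe_nsmul, nsmul_eq_mul, mul_comm]
  unfold TropPoly.monoT ell lpt
  simp only [h]
  rw [WithTop.coe_add, WithTop.coe_sum]

lemma monoT_extT_of_not_sub {n : ℕ} (f : TropPoly n) (A : Finset (Fin n)) (a : Fin n → ℝ)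
    (u : Exp n) (j : Fin n) (hj : u j ≠ 0) (hjA : j ∉ A) :
    f.monoT u (extT A a) = ⊤ := by
  unfold TropPoly.monoT
  have : ∑ j, u j • extT A a j = ⊤ := by
    rw [← Finset.add_sum_erase _ _ (Finset.mem_univ j)]
    simp [extT, hjA, nsmul_top_ne hj]
  rw [this, WithTop.add_top]

/-- The one-sided comparison. -/
lemma half_compare {n N : ℕ} (f g : TropPoly n) (m : Exp n → ℝ)
    (hf : ∀ u ∈ f.supp, m u ≤ f.coeff u) (hg : ∀ u ∈ g.supp, m u ≤ g.coeff u)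
    (hfg : ∀ u ∈ f.supp ∪ g.supp,
      (u ∈ f.supp ∧ m u = f.coeff u) ∨ (u ∈ g.supp ∧ m u = g.coeff u))
    (y : Exp n → WithTop ℝ) (a : Fin n → ℝ) (A : Finset (Fin n)) (I v : Exp n)
    (hIN : expDeg I ≤ N) (hIy : y I ≠ ⊤)
    (hv : v ∈ f.supp ∪ g.supp) (hvI : v ≤ I)
    (hvmin : ∀ u ∈ f.supp ∪ g.supp, ell a (lpt m v) ≤ ell a (lpt m u))
    (hinn : ∀ u ∈ f.supp ∪ g.supp, ell a (lpt m u) ≤ ell a (lpt m v) → ∀ j, u j ≠ 0 → j ∈ A)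
    (hcmp : ∀ u ∈ f.supp ∪ g.supp, ∀ Q ∈ (degLE n N).filter (fun Q => y Q ≠ ⊤), Q + v = I + u →
      m v + (y I).untopD 0 ≤ m u + (y Q).untopD 0 ∧
      (m u + (y Q).untopD 0 ≤ m v + (y I).untopD 0 → ell a (lpt m u) ≤ ell a (lpt m v)))
    (heq : macMinLE f (I - v) y N = macMinLE g (I - v) y N) :
    g.evalT (extT A a) ≤ f.evalT (extT A a) := by
  have hell : ∀ (m₁ m₂ : Exp n → ℝ) (u : Exp n), ell a (lpt m₁ u) = ell a (lpt m₂ u) + m₁ u - m₂ u := by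
    intro m₁ m₂ u
    simp only [ell, lpt]; ring
  by_contra hlt
  push Not at hlt
  obtain ⟨u0, hu0, hu0e⟩ := Finset.exists_mem_eq_inf f.supp f.supp_nonempty
    (fun I => f.monoT I (extT A a))
  have hfe : f.evalT (extT A a) = f.monoT u0 (extT A a) := hu0e
  have hu0A : ∀ j, u0 j ≠ 0 → j ∈ A := by
    intro j hj
    by_contra hjA
    rw [hfe, monoT_extT_of_not_sub f A a u0 j hj hjA] at hlt
    exact not_top_lt hlt
  rw [hfe, monoT_extT_of_sub f A a u0 hu0A] at hlt
  have hno : ∀ u ∈ g.supp, m u = g.coeff u → ell a (lpt m u) ≤ ell a (lpt m v) → False := by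
    intro u hu hmu hle
    have huS : u ∈ f.supp ∪ g.supp := Finset.mem_union_right _ hu
    have hA := hinn u huS hle
    have h1 : g.evalT (extT A a) ≤ g.monoT u (extT A a) :=
      Finset.inf_le (f := fun I => g.monoT I (extT A a)) hu
    rw [monoT_extT_of_sub g A a u hA] at h1
    have h2 := lt_of_lt_of_le hlt h1
    rw [WithTop.coe_lt_coe] at h2
    have h3 := hvmin u0 (Finset.mem_union_left _ hu0)
    have h4 := hell g.coeff m u
    have h5 := hell f.coeff m u0
    have h6 := hf u0 hu0
    linarith
  have hvf : v ∈ f.supp ∧ m v = f.coeff v := by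
    rcases hfg v hv with h | h
    · exact h
    · exact (hno v h.1 h.2 le_rfl).elim
  have hIeq : I - (I - v) = v := tsub_tsub_cancel_of_le hvI
  obtain ⟨yI, hyI⟩ := WithTop.ne_top_iff_exists.1 hIy
  have hfle : macMinLE f (I - v) y N ≤ ((m v + yI : ℝ) : WithTop ℝ) := by
    have h1 : macMinLE f (I - v) y N ≤ macVal f (I - v) y I :=
      Finset.inf_le ((mem_degLE I).2 hIN)
    refine h1.trans (le_of_eq ?_)
    unfold macVal shiftCoeff
    rw [if_pos ⟨tsub_le_self, by rw [hIeq]; exact hvf.1⟩, hIeq, ← hyI, hvf.2, WithTop.coe_add]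
  rw [heq] at hfle
  obtain ⟨Q, hQ, hQe⟩ := Finset.exists_mem_eq_inf (degLE n N) ⟨I, (mem_degLE I).2 hIN⟩
    (fun I' => macVal g (I - v) y I')
  have hQle : macVal g (I - v) y Q ≤ ((m v + yI : ℝ) : WithTop ℝ) := hQe ▸ hfle
  unfold macVal shiftCoeff at hQle
  split_ifs at hQle with hcond
  swap
  · rw [WithTop.top_add] at hQle
    exact absurd (top_le_iff.1 hQle) WithTop.coe_ne_top
  have hQy : y Q ≠ ⊤ := by
    intro h
    rw [h, WithTop.add_top] at hQle
    exact absurd (top_le_iff.1 hQle) WithTop.coe_ne_top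
  obtain ⟨yQ, hyQ⟩ := WithTop.ne_top_iff_exists.1 hQy
  rw [← hyQ, ← WithTop.coe_add, WithTop.coe_le_coe] at hQle
  obtain ⟨hJQ, hug⟩ := hcond
  set u := Q - (I - v) with hu
  have hQv : Q + v = I + u := by
    funext j
    have e1 := hJQ j
    have e2 := hvI j
    simp only [hu, Pi.add_apply, Pi.sub_apply] at *
    omega
  have huS : u ∈ f.supp ∪ g.supp := Finset.mem_union_right _ hug
  have hc := hcmp u huS Q (Finset.mem_filter.2 ⟨hQ, hQy⟩) hQv
  rw [← hyI, ← hyQ] at hc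
  simp only [WithTop.untopD_coe] at hc
  have hgu := hg u hug
  exact hno u hug (by linarith [hc.1]) (hc.2 (by linarith))

/-- The easy direction: evaluation of the Macaulay rows at a Veronese-like point. -/
lemma macMinLE_root {n N : ℕ} (f : TropPoly n) (J : Exp n) (a : Fin n → WithTop ℝ)
    (h : expDeg J + f.deg ≤ N) :
    macMinLE f J (fun I => ∑ j, I j • a j) N = f.evalT a + ∑ j, J j • a j := by
  have hadd : ∀ u : Exp n, ∑ j, (J + u) j • a j = ∑ j, J j • a j + ∑ j, u j • a j := by
    intro u
    rw [← Finset.sum_add_distrib]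
    exact Finset.sum_congr rfl fun j _ => by rw [Pi.add_apply, add_nsmul]
  apply le_antisymm
  · obtain ⟨u, hu, hue⟩ := Finset.exists_mem_eq_inf f.supp f.supp_nonempty
      (fun I => f.monoT I a)
    have hfe : f.evalT a = f.monoT u a := hue
    have hud : expDeg u ≤ f.deg := Finset.le_sup hu
    have hmem : J + u ∈ degLE n N := by
      rw [mem_degLE]
      have : expDeg (J + u) = expDeg J + expDeg u := by
        simp [expDeg, Finset.sum_add_distrib]
      omega
    refine (Finset.inf_le (f := macVal f J (fun I => ∑ j, I j • a j)) hmem).trans (le_of_eq ?_)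
    unfold macVal shiftCoeff
    have hsub : J + u - J = u := add_tsub_cancel_left J u
    rw [if_pos ⟨le_self_add, by rw [hsub]; exact hu⟩, hsub, hfe]
    simp only [hadd]
    unfold TropPoly.monoT
    rw [add_assoc, add_comm (∑ j, u j • a j)]
  · refine Finset.le_inf fun I _ => ?_
    unfold macVal shiftCoeff
    split_ifs with hc
    · obtain ⟨hJI, hu⟩ := hc
      set u := I - J with hudef
      have hI : I = J + u := (add_tsub_cancel_of_le hJI).symm
      have h1 : f.evalT a ≤ f.monoT u a := Finset.inf_le (f := fun I => f.monoT I a) hu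
      have h2 := hadd u
      rw [← hI] at h2
      simp only [h2]
      rw [add_comm (∑ j, J j • a j), ← add_assoc]
      exact add_le_add_left h1 _
    · rw [WithTop.top_add]; exact le_top

/-- Numerical estimate. -/
lemma numeric_bound (n k d e : ℕ) (hk : 1 ≤ k) (hd : 1 ≤ d) (K L t : ℝ) (hK : 0 < K)
    (hL : L = 2 * (K * (2 * d) ^ e) + 2 * K) (C : ℝ) (hC : C ≤ K)
    (ht : t ≤ k * d) (S : ℕ)
    (h : K * ((S : ℝ) - ((n:ℝ) + 2) * t - n * d) ≤
      L * (((n:ℝ) + 2) * t + n * d) + n * ((L + K) / 2) + C) :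
    S + d ≤ 2 * (n + 2) ^ 2 * k * (4 * d) ^ (e + 2) := by
  have hd' : (1:ℝ) ≤ d := by exact_mod_cast hd
  have hk' : (1:ℝ) ≤ k := by exact_mod_cast hk
  have hn0 : (0:ℝ) ≤ n := Nat.cast_nonneg n
  set X : ℝ := (2 * (d:ℝ)) ^ e with hX
  have hX1 : 1 ≤ X := one_le_pow₀ (by linarith)
  have hX4 : X ≤ (4 * (d:ℝ)) ^ e := pow_le_pow_left₀ (by linarith) (by linarith) e
  set q : ℝ := ((n:ℝ) + 2) * (k * d) with hq
  have hkd : 1 ≤ (k:ℝ) * d := one_le_mul_of_one_le_of_one_le hk' hd'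
  have hdkd : (d:ℝ) ≤ k * d := by nlinarith
  have hnd : (n:ℝ) * d ≤ q := by rw [hq]; nlinarith
  have hnq : (n:ℝ) ≤ q := by rw [hq]; nlinarith
  have hdq : (d:ℝ) ≤ q := by rw [hq]; nlinarith
  have h1q : 1 ≤ q := by linarith
  have htq : ((n:ℝ) + 2) * t ≤ q := by
    rw [hq]; exact mul_le_mul_of_nonneg_left ht (by linarith)
  have hL' : L = K * (2 * X + 2) := by rw [hL]; ring
  set r : ℝ := ((n:ℝ) + 2) * t + n * d with hr
  have hr2 : r ≤ 2 * q := by linarith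
  have hmain : K * (S : ℝ) ≤ K * (r + (2 * X + 2) * r + n * ((2 * X + 3) / 2) + 1) := by
    have : L * r + n * ((L + K) / 2) + C ≤ K * ((2 * X + 2) * r + n * ((2 * X + 3) / 2) + 1) := by
      have e0 : K * ((2 * X + 2) * r + n * ((2 * X + 3) / 2) + 1)
          = L * r + n * ((L + K) / 2) + K := by rw [hL']; ring
      rw [e0]; linarith
    have e1 : K * ((S : ℝ) - ((n:ℝ) + 2) * t - n * d) = K * S - K * r := by rw [hr]; ring
    rw [e1] at h
    linarith
  have hS : (S : ℝ) ≤ r + (2 * X + 2) * r + n * ((2 * X + 3) / 2) + 1 :=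
    le_of_mul_le_mul_left hmain hK
  have hXq : q ≤ X * q := by nlinarith
  have hS2 : (S : ℝ) + d ≤ 16 * (X * q) := by
    have a1 : (2 * X + 3) * r ≤ (2 * X + 3) * (2 * q) :=
      mul_le_mul_of_nonneg_left hr2 (by linarith)
    have a2 : (n:ℝ) * ((2 * X + 3) / 2) ≤ q * ((2 * X + 3) / 2) :=
      mul_le_mul_of_nonneg_right hnq (by linarith)
    have e3 : (2 * X + 3) * (2 * q) = 4 * (X * q) + 6 * q := by ring
    have e4 : q * ((2 * X + 3) / 2) = X * q + 3 / 2 * q := by ring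
    have e5 : r + (2 * X + 2) * r = (2 * X + 3) * r := by ring
    linarith
  have hfin : 16 * (X * q) ≤ 2 * ((n:ℝ) + 2) ^ 2 * k * (4 * d) ^ (e + 2) := by
    have b1 : X * q ≤ (4 * (d:ℝ)) ^ e * q := mul_le_mul_of_nonneg_right hX4 (by linarith)
    have hpw : (0:ℝ) < (4 * (d:ℝ)) ^ e := by positivity
    have b2 : q ≤ ((n:ℝ) + 2) ^ 2 * k * d ^ 2 := by
      have c1 : ((n:ℝ) + 2) ^ 2 * k * d ^ 2 = q * (((n:ℝ) + 2) * d) := by rw [hq]; ring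
      rw [c1]
      have c2 : 1 ≤ ((n:ℝ) + 2) * d := by nlinarith
      nlinarith
    have b3 : (4 * (d:ℝ)) ^ e * q ≤ (4 * (d:ℝ)) ^ e * (((n:ℝ) + 2) ^ 2 * k * d ^ 2) :=
      mul_le_mul_of_nonneg_left b2 hpw.le
    have b4 : 2 * ((n:ℝ) + 2) ^ 2 * k * (4 * d) ^ (e + 2)
        = 32 * ((4 * (d:ℝ)) ^ e * (((n:ℝ) + 2) ^ 2 * k * d ^ 2)) := by
      rw [pow_add]; ring
    rw [b4]
    have : 0 ≤ X * q := by linarith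
    linarith
  have := hS2.trans hfin
  exact_mod_cast this

/-- The combined coefficient. -/
noncomputable def mcoef {n : ℕ} (f g : TropPoly n) (u : Exp n) : ℝ :=
  if u ∈ f.supp then (if u ∈ g.supp then min (f.coeff u) (g.coeff u) else f.coeff u)
  else g.coeff u

lemma mcoef_left {n : ℕ} (f g : TropPoly n) (u : Exp n) (hu : u ∈ f.supp) :
    mcoef f g u ≤ f.coeff u := by
  unfold mcoef
  rw [if_pos hu]
  split_ifs
  · exact min_le_left _ _
  · exact le_rfl

lemma mcoef_right {n : ℕ} (f g : TropPoly n) (u : Exp n) (hu : u ∈ g.supp) :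
    mcoef f g u ≤ g.coeff u := by
  unfold mcoef
  split_ifs
  · exact min_le_right _ _
  · exact le_rfl

lemma mcoef_cases {n : ℕ} (f g : TropPoly n) (u : Exp n) (hu : u ∈ f.supp ∪ g.supp) :
    (u ∈ f.supp ∧ mcoef f g u = f.coeff u) ∨ (u ∈ g.supp ∧ mcoef f g u = g.coeff u) := by
  unfold mcoef
  by_cases hf : u ∈ f.supp
  · by_cases hg : u ∈ g.supp
    · simp only [hf, hg, if_true, true_and]
      exact min_choice _ _
    · simp [hf, hg]
  · have hg : u ∈ g.supp := (Finset.mem_union.1 hu).resolve_left hf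
    simp [hf, hg]

lemma coord_le_expDeg {n : ℕ} (u : Exp n) (j : Fin n) : u j ≤ expDeg u :=
  Finset.single_le_sum (f := u) (fun i _ => Nat.zero_le _) (Finset.mem_univ j)

/-- **Min-plus dual Nullstellensatz over ℝ∞** : a system `F = {(f_1,g_1), …, (f_k,g_k)}`
of min-plus polynomials in `n` variables over `ℝ∞`, each of degree at most `d ≥ 1`, has a
root iff the non-homogeneous Macaulay min-plus linear system
`Ml_N ⊙ (0,y) = Mr_N ⊙ (0,y)` with `N = 2(n+2)²·k·(4d)^{min(n,k)+2}` has a solution. -/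
theorem minplus_dual_nullstellensatz_inf (n k d : ℕ) (hk : 1 ≤ k) (hd : 1 ≤ d)
    (F : Fin k → TropPoly n × TropPoly n)
    (hdeg : ∀ j : Fin k, max (F j).1.deg (F j).2.deg ≤ d) :
    (∃ a : Fin n → WithTop ℝ, ∀ j : Fin k, (F j).1.evalT a = (F j).2.evalT a) ↔
      (∃ y : Exp n → WithTop ℝ, y 0 = 0 ∧
        IsMPMacaulaySolT F (2 * (n + 2) ^ 2 * k * (4 * d) ^ (min n k + 2)) y) := by
  constructor
  · rintro ⟨a, ha⟩
    refine ⟨fun I => ∑ j, I j • a j, by simp, fun i J hJ => ?_⟩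
    rw [macMinLE_root _ _ _ ((Nat.add_le_add_left (le_max_left _ _) _).trans hJ),
      macMinLE_root _ _ _ ((Nat.add_le_add_left (le_max_right _ _) _).trans hJ), ha i]
  rintro ⟨y, hy0, hy⟩
  set e := min n k with he
  set N := 2 * (n + 2) ^ 2 * k * (4 * d) ^ (e + 2) with hN
  set P : Fin k → Finset (Exp n) := fun i => (F i).1.supp ∪ (F i).2.supp with hP
  set m : Fin k → Exp n → ℝ := fun i => mcoef (F i).1 (F i).2 with hm
  set Y : Finset (Exp n) := (degLE n N).filter (fun Q => y Q ≠ ⊤) with hY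
  set yr : Exp n → ℝ := fun Q => (y Q).untopD 0 with hyr
  have hPd : ∀ i, ∀ u ∈ P i, expDeg u ≤ d := by
    intro i u hu
    refine le_trans ?_ (hdeg i)
    rcases Finset.mem_union.1 hu with h | h
    · exact (Finset.le_sup (f := expDeg) h).trans (le_max_left _ _)
    · exact (Finset.le_sup (f := expDeg) h).trans (le_max_right _ _)
  have h0Y : (0 : Exp n) ∈ Y := by
    rw [hY, Finset.mem_filter, mem_degLE, hy0]
    exact ⟨by simp [expDeg], WithTop.zero_ne_top⟩
  have hyr0 : yr 0 = 0 := by simp [hyr, hy0]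
  obtain ⟨C, hC0, hCm, hCy⟩ : ∃ C : ℝ, 0 ≤ C ∧ (∀ i, ∀ u ∈ P i, |m i u| ≤ C) ∧
      ∀ Q ∈ Y, |yr Q| ≤ C := by
    refine ⟨∑ i, ∑ u ∈ P i, |m i u| + ∑ Q ∈ Y, |yr Q|, by positivity, ?_, ?_⟩
    · intro i u hu
      have h1 : |m i u| ≤ ∑ u ∈ P i, |m i u| :=
        Finset.single_le_sum (f := fun u => |m i u|) (fun _ _ => abs_nonneg _) hu
      have h2 : ∑ u ∈ P i, |m i u| ≤ ∑ i, ∑ u ∈ P i, |m i u| :=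
        Finset.single_le_sum (f := fun i => ∑ u ∈ P i, |m i u|)
          (fun _ _ => Finset.sum_nonneg fun _ _ => abs_nonneg _) (Finset.mem_univ i)
      have h3 : 0 ≤ ∑ Q ∈ Y, |yr Q| := Finset.sum_nonneg fun _ _ => abs_nonneg _
      linarith
    · intro Q hQ
      have h1 : |yr Q| ≤ ∑ Q ∈ Y, |yr Q| :=
        Finset.single_le_sum (f := fun u => |yr u|) (fun _ _ => abs_nonneg _) hQ
      have h3 : 0 ≤ ∑ i, ∑ u ∈ P i, |m i u| :=
        Finset.sum_nonneg fun _ _ => Finset.sum_nonneg fun _ _ => abs_nonneg _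
      linarith
  set K : ℝ := 2 * C + 1 with hK
  have hKpos : 0 < K := by linarith
  have hd' : (1:ℝ) ≤ d := by exact_mod_cast hd
  set L : ℝ := 2 * (K * (2 * d) ^ e) + 2 * K with hL
  have hLpos : 0 < L := by positivity
  have hLK : 0 ≤ L + K := by linarith
  obtain ⟨I, hIY, W, hW, hopt, hcore⟩ := core_opt P
    (fun i => (F i).1.supp_nonempty.mono Finset.subset_union_left) m Y ⟨0, h0Y⟩ yr
    (thetaF L K d) (thetaD L K d) (thetaF_deriv L K d) ((n:ℝ) + 2) rfl
  set T : LSp n := ∑ i, W i with hT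
  set a : Fin n → ℝ := fun j => thetaD L K d ((I j : ℝ) - ((n:ℝ) + 2) * T.1 j) with ha
  have hcore := hcore a rfl
  have hTj : ∀ j, T.1 j = ∑ i, (W i).1 j := by
    intro j
    simp [hT, Prod.fst_sum, Finset.sum_apply]
  have hT0 : ∀ j, 0 ≤ T.1 j := by
    intro j
    rw [hTj]
    exact Finset.sum_nonneg fun i _ => (hull_bounds (P i) (m i) (hPd i) (W i) (hW i)).1 j
  have hTs : ∑ j, T.1 j ≤ k * d := by
    simp only [hTj]
    rw [Finset.sum_comm]
    calc ∑ i, ∑ j, (W i).1 j ≤ ∑ _i : Fin k, (d : ℝ) :=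
          Finset.sum_le_sum fun i _ => (hull_bounds (P i) (m i) (hPd i) (W i) (hW i)).2
      _ = k * d := by simp
  have hn2 : (0:ℝ) < (n:ℝ) + 2 := by positivity
  have hIdeg : expDeg I + d ≤ N := by
    have h1 := hopt 0 h0Y W hW
    rw [← hT] at h1
    unfold gobj at h1
    rw [hyr0] at h1
    have h2 : ∑ j, thetaF L K d ((I j : ℝ) - ((n:ℝ) + 2) * T.1 j) ≤
        ∑ j, (-K * ((I j : ℝ) - ((n:ℝ) + 2) * T.1 j - d)) :=
      Finset.sum_le_sum fun j _ => thetaF_le L K d _ hLK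
    have h3 : ∑ j, (L * ((((0 : Exp n) j : ℕ) : ℝ) - ((n:ℝ) + 2) * T.1 j - d) - (L + K) / 2) ≤
        ∑ j, thetaF L K d ((((0 : Exp n) j : ℕ) : ℝ) - ((n:ℝ) + 2) * T.1 j) := by
      refine Finset.sum_le_sum fun j _ => le_thetaF L K d _ hLK ?_
      have := mul_nonneg hn2.le (hT0 j)
      simp only [Pi.zero_apply, Nat.cast_zero]
      linarith
    have h4 := (abs_le.1 (hCy I hIY)).1
    have e2 : ∑ j, (-K * ((I j : ℝ) - ((n:ℝ) + 2) * T.1 j - d))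
        = -(K * (((expDeg I : ℕ) : ℝ) - ((n:ℝ) + 2) * (∑ j, T.1 j) - n * d)) := by
      rw [← Finset.mul_sum]
      simp only [Finset.sum_sub_distrib, ← Finset.mul_sum, expDeg, Nat.cast_sum,
        Finset.sum_const, Finset.card_univ, Fintype.card_fin, nsmul_eq_mul]
      ring
    have e3 : ∑ j, (L * ((((0 : Exp n) j : ℕ) : ℝ) - ((n:ℝ) + 2) * T.1 j - d) - (L + K) / 2)
        = -(L * (((n:ℝ) + 2) * (∑ j, T.1 j) + n * d) + n * ((L + K) / 2)) := by
      simp only [Pi.zero_apply, Nat.cast_zero, Finset.sum_sub_distrib, ← Finset.mul_sum,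
        Finset.sum_const, Finset.card_univ, Fintype.card_fin, nsmul_eq_mul]
      ring
    rw [e2] at h2
    rw [e3] at h3
    refine numeric_bound n k d e hk hd K L (∑ j, T.1 j) hKpos hL C (by linarith) hTs _ ?_
    linarith
  have haK : ∀ j, -K ≤ a j := fun j => thetaD_ge L K d _ hLK
  have haI : ∀ j, a j ≤ K * (2 * d) ^ e → d ≤ I j := by
    intro j hj
    by_contra hlt
    push Not at hlt
    have h1 : (I j : ℝ) - ((n:ℝ) + 2) * T.1 j ≤ d := by
      have h2 : (I j : ℝ) ≤ d := by exact_mod_cast hlt.le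
      have := mul_nonneg hn2.le (hT0 j)
      linarith
    have h2 : (L - K) / 2 ≤ a j := thetaD_ge_of_le L K d _ hLK h1
    linarith
  set A : ℕ → Finset (Fin n) := fun l => Finset.univ.filter (fun j => a j ≤ K * (2 * d) ^ l)
    with hA
  have hAmem : ∀ l j, j ∈ A l ↔ a j ≤ K * (2 * d) ^ l := by
    intro l j
    simp [hA]
  have hpowmono : ∀ l l' : ℕ, l ≤ l' → K * (2 * (d:ℝ)) ^ l ≤ K * (2 * d) ^ l' := fun l l' h =>
    mul_le_mul_of_nonneg_left (pow_le_pow_right₀ (by linarith) h) hKpos.le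
  have hAmono : Monotone A := by
    intro l l' h j hj
    rw [hAmem] at hj ⊢
    exact hj.trans (hpowmono l l' h)
  obtain ⟨l, hle, hgood⟩ := good_level n k A hAmono
    (fun i l => ∃ v ∈ P i, ∀ j, v j ≠ 0 → j ∈ A l)
    (fun i l => ∀ u ∈ P i, (∀ v ∈ P i, ell a (lpt (m i) u) ≤ ell a (lpt (m i) v)) →
      ∀ j, u j ≠ 0 → j ∈ A l) (by
      rintro i l l' hll ⟨v, hv, hvA⟩ u hu humin j hj
      refine hAmono (show l + 1 ≤ l' from hll) ?_
      rw [hAmem]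
      have h1 := humin v hv
      unfold ell lpt at h1
      simp only at h1
      set τ := K * (2 * (d:ℝ)) ^ l with hτ
      have hτK : K ≤ τ := by
        have := hpowmono 0 l (Nat.zero_le l)
        simpa using this
      have hm1 := (abs_le.1 (hCm i u hu)).1
      have hm2 := (abs_le.1 (hCm i v hv)).2
      have hvsum : ∑ j, a j * (v j : ℝ) ≤ τ * d := by
        calc ∑ j, a j * (v j : ℝ) ≤ ∑ j, τ * (v j : ℝ) := by
              refine Finset.sum_le_sum fun j _ => ?_
              by_cases h0 : v j = 0
              · simp [h0]
              · exact mul_le_mul_of_nonneg_right ((hAmem l j).1 (hvA j h0)) (Nat.cast_nonneg _)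
          _ = τ * ((expDeg v : ℕ) : ℝ) := by
              rw [← Finset.mul_sum]; simp [expDeg]
          _ ≤ τ * d := by
              refine mul_le_mul_of_nonneg_left ?_ (by linarith)
              exact_mod_cast hPd i v hv
      have huj : (1:ℝ) ≤ u j := by
        exact_mod_cast Nat.one_le_iff_ne_zero.2 hj
      have husum : a j + K - K * d ≤ ∑ j, a j * (u j : ℝ) := by
        have h2 : a j + K ≤ ∑ j, (a j + K) * (u j : ℝ) := by
          have h3 : (a j + K) * (u j : ℝ) ≤ ∑ j, (a j + K) * (u j : ℝ) :=
            Finset.single_le_sum (f := fun j => (a j + K) * (u j : ℝ))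
              (fun j _ => mul_nonneg (by linarith [haK j]) (Nat.cast_nonneg _))
              (Finset.mem_univ j)
          have h4 : 0 ≤ a j + K := by linarith [haK j]
          nlinarith
        have h5 : ∑ j, (a j + K) * (u j : ℝ)
            = ∑ j, a j * (u j : ℝ) + K * ((expDeg u : ℕ) : ℝ) := by
          simp only [add_mul, Finset.sum_add_distrib, ← Finset.mul_sum, expDeg, Nat.cast_sum]
        have h6 : K * ((expDeg u : ℕ) : ℝ) ≤ K * d :=
          mul_le_mul_of_nonneg_left (by exact_mod_cast hPd i u hu) hKpos.le
        linarith
      have e1 : K * (2 * (d:ℝ)) ^ (l + 1) = 2 * (τ * d) := by rw [hτ, pow_succ]; ring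
      rw [e1]
      have h7 : K * d ≤ τ * d := mul_le_mul_of_nonneg_right hτK (by linarith)
      linarith) (by
      intro i l l' hsub hin u hu humin j hj
      exact hsub (hin u hu humin j hj))
  refine ⟨extT (A l) a, fun i => ?_⟩
  have hIN : expDeg I ≤ N := by omega
  have hIy : y I ≠ ⊤ := (Finset.mem_filter.1 hIY).2
  by_cases hact : ∃ v ∈ P i, ∀ j, v j ≠ 0 → j ∈ A l
  · have hin := hgood i hact
    obtain ⟨v, hv, hvmin, hvcmp⟩ := hcore i
    have hinn : ∀ u ∈ P i, ell a (lpt (m i) u) ≤ ell a (lpt (m i) v) → ∀ j, u j ≠ 0 → j ∈ A l :=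
      fun u hu hle' => hin u hu fun w hw => hle'.trans (hvmin w hw)
    have hvI : v ≤ I := by
      intro j
      by_cases h0 : v j = 0
      · rw [h0]; exact Nat.zero_le _
      · have h1 := (hAmem l j).1 (hinn v hv le_rfl j h0)
        exact ((coord_le_expDeg v j).trans (hPd i v hv)).trans
          (haI j (h1.trans (hpowmono l e hle)))
    have hJ : expDeg (I - v) + max (F i).1.deg (F i).2.deg ≤ N := by
      have h1 : expDeg (I - v) ≤ expDeg I :=
        Finset.sum_le_sum fun j _ => Nat.sub_le _ _
      have := hdeg i
      omega
    have heq := hy i (I - v) hJ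
    apply le_antisymm
    · refine half_compare (F i).2 (F i).1 (m i) (mcoef_right _ _) (mcoef_left _ _) ?_ y a (A l) I v
        hIN hIy ?_ hvI ?_ ?_ ?_ heq.symm
      · intro u hu
        exact (mcoef_cases _ _ u (by rwa [Finset.union_comm])).symm
      · rw [Finset.union_comm]; exact hv
      · rw [Finset.union_comm]; exact hvmin
      · rw [Finset.union_comm]; exact hinn
      · rw [Finset.union_comm]; exact hvcmp
    · exact half_compare (F i).1 (F i).2 (m i) (mcoef_left _ _) (mcoef_right _ _)
        (mcoef_cases _ _) y a (A l) I v hIN hIy hv hvI hvmin hinn hvcmp heq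
  · push Not at hact
    have htop : ∀ f : TropPoly n, f.supp ⊆ P i → f.evalT (extT (A l) a) = ⊤ := by
      intro f hf
      refine top_le_iff.1 (Finset.le_inf fun u hu => ?_)
      obtain ⟨j, hj, hjA⟩ := hact u (hf hu)
      rw [monoT_extT_of_not_sub f (A l) a u j hj hjA]
    rw [htop _ Finset.subset_union_left, htop _ Finset.subset_union_right]
end

section
/- Let F = {(f_1, g_1), …, (f_k, g_k)} (k ≥ 1) be a system of min-plus polynomials in n variables over ℝ. Then F has a root in ℝ^n if and only if the infinite Macaulay min-plus linear system of F has a solution. -/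
open scoped Classical

/-- The minimum over all `I ∈ ℕ^n` of `c_f(I-J) + y_I`, i.e. over the finitely many `I`
for which the coefficient `c_f(I-J)` is finite (namely `I = J + I'` with `I'` in the
support of `f`). -/
noncomputable def macMinInf {n : ℕ} (f : TropPoly n) (J : Exp n)
    (y : Exp n → WithTop ℝ) : WithTop ℝ :=
  f.supp.inf (fun I' => (f.coeff I' : WithTop ℝ) + y (J + I'))

/-- `y` is a solution of the infinite Macaulay min-plus linear system of `F` over `ℝ`. -/
noncomputable def IsMPInfMacaulaySol {n k : ℕ} (F : Fin k → TropPoly n × TropPoly n)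
    (y : Exp n → ℝ) : Prop :=
  ∀ j : Fin k, ∀ J : Exp n,
    macMinInf (F j).1 J (fun I => (y I : WithTop ℝ)) =
      macMinInf (F j).2 J (fun I => (y I : WithTop ℝ))

/-- Finite families of lower and upper bounds can be separated. -/
lemma exists_sep {ι : Type} [Fintype ι] (P N : ι → Prop) (u : ι → ℝ)
    (h : ∀ i j, P i → N j → u j ≤ u i) :
    ∃ x : ℝ, (∀ i, P i → x ≤ u i) ∧ (∀ j, N j → u j ≤ x) := by
  by_cases hN : (Finset.univ.filter N).Nonempty
  · obtain ⟨j, hj, hmax⟩ := Finset.exists_max_image _ u hN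
    refine ⟨u j, fun i hi => h i j hi (by simpa using hj), fun j' hj' => hmax j' (by simpa using hj')⟩
  · have hN' : ∀ j, ¬ N j := by
      intro j hj
      exact hN ⟨j, by simpa using hj⟩
    by_cases hP : (Finset.univ.filter P).Nonempty
    · obtain ⟨j, hj, hmin⟩ := Finset.exists_min_image _ u hP
      exact ⟨u j, fun i hi => hmin i (by simpa using hi), fun j' hj' => absurd hj' (hN' j')⟩
    · refine ⟨0, fun i hi => absurd ⟨i, by simpa using hi⟩ hP, fun j' hj' => absurd hj' (hN' j')⟩

/-- Farkas' lemma, proved by Fourier-Motzkin elimination. -/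
lemma farkas_fin (d : ℕ) : ∀ (ι : Type) [Fintype ι] (v : ι → Fin d → ℝ) (c : ι → ℝ),
    (∀ μ : ι → ℝ, (∀ i, 0 ≤ μ i) → (∀ l, ∑ i, μ i * v i l = 0) → 0 ≤ ∑ i, μ i * c i) →
    ∃ x : Fin d → ℝ, ∀ i, ∑ l, v i l * x l ≤ c i := by
  induction d with
  | zero =>
    intro ι _ v c h
    refine ⟨0, fun i => ?_⟩
    have := h (Pi.single i 1) (fun j => by
      by_cases hj : j = i
      · subst hj; simp
      · simp [hj]) (fun l => l.elim0)
    simpa [Pi.single_apply] using this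
  | succ d ih =>
    intro ι _ v c h
    let α : ι × ι → ℝ := fun q =>
      if 0 < v q.1 0 ∧ v q.2 0 < 0 then - v q.2 0 else if v q.1 0 = 0 then 1 else 0
    let β : ι × ι → ℝ := fun q => if 0 < v q.1 0 ∧ v q.2 0 < 0 then v q.1 0 else 0
    have hα : ∀ q, 0 ≤ α q := by
      intro q; simp only [α]; split_ifs with h1 h2 <;> linarith
    have hβ : ∀ q, 0 ≤ β q := by
      intro q; simp only [β]; split_ifs with h1 <;> linarith
    have hαβ : ∀ q, α q * v q.1 0 + β q * v q.2 0 = 0 := by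
      intro q; simp only [α, β]; split_ifs with h1 h2
      · ring
      · simp [h2]
      · ring
    obtain ⟨x, hx⟩ := ih (ι × ι) (fun q l => α q * v q.1 l.succ + β q * v q.2 l.succ)
      (fun q => α q * c q.1 + β q * c q.2) (by
        intro μ hμ hz
        have key : ∀ w : ι → ℝ,
            ∑ i, (∑ j, μ (i, j) * α (i, j) + ∑ j, μ (j, i) * β (j, i)) * w i
              = ∑ q, μ q * (α q * w q.1 + β q * w q.2) := by
          intro w
          rw [Fintype.sum_prod_type]
          simp only [add_mul, mul_add, Finset.sum_add_distrib, Finset.sum_mul]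
          congr 1
          · simp only [mul_assoc]
          · rw [Finset.sum_comm]
            simp only [mul_assoc]
        rw [← key]
        apply h
        · intro i
          exact add_nonneg (Finset.sum_nonneg fun j _ => mul_nonneg (hμ _) (hα _))
            (Finset.sum_nonneg fun j _ => mul_nonneg (hμ _) (hβ _))
        · intro l
          rw [key (fun i => v i l)]
          refine Fin.cases ?_ (fun l => ?_) l
          · apply Finset.sum_eq_zero
            intro q _
            rw [hαβ, mul_zero]
          · exact hz l)
    let s : ι → ℝ := fun i => ∑ l : Fin d, v i l.succ * x l
    have hx' : ∀ q : ι × ι, α q * s q.1 + β q * s q.2 ≤ α q * c q.1 + β q * c q.2 := by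
      intro q
      refine le_trans (le_of_eq ?_) (hx q)
      simp only [s, add_mul, Finset.sum_add_distrib, Finset.mul_sum, mul_assoc]
    obtain ⟨x0, h1, h2⟩ := exists_sep (fun i => 0 < v i 0) (fun j => v j 0 < 0)
      (fun i => (c i - s i) / v i 0) (by
        intro i j hi hj
        have := hx' (i, j)
        simp only [α, β, hi, hj, and_self, if_true] at this
        rw [div_le_iff_of_neg hj, div_mul_eq_mul_div, div_le_iff₀ hi]
        nlinarith)
    refine ⟨Fin.cons x0 x, fun i => ?_⟩
    rw [Fin.sum_univ_succ]
    simp only [Fin.cons_zero, Fin.cons_succ]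
    change v i 0 * x0 + s i ≤ c i
    rcases lt_trichotomy (v i 0) 0 with hi | hi | hi
    · have := h2 i hi
      rw [div_le_iff_of_neg hi] at this
      linarith
    · have := hx' (i, i)
      simp [α, β, hi] at this
      rw [hi]; linarith
    · have := h1 i hi
      rw [le_div_iff₀ hi] at this
      linarith

lemma farkas_type {δ : Type} [Fintype δ] {ι : Type} [Fintype ι] (v : ι → δ → ℝ) (c : ι → ℝ)
    (h : ∀ μ : ι → ℝ, (∀ i, 0 ≤ μ i) → (∀ l, ∑ i, μ i * v i l = 0) → 0 ≤ ∑ i, μ i * c i) :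
    ∃ x : δ → ℝ, ∀ i, ∑ l, v i l * x l ≤ c i := by
  let E := Fintype.equivFin δ
  obtain ⟨x, hx⟩ := farkas_fin (Fintype.card δ) ι (fun i l => v i (E.symm l)) c (by
    intro μ hμ hz
    exact h μ hμ (fun l => by simpa using hz (E l)))
  refine ⟨fun l => x (E l), fun i => ?_⟩
  rw [← E.symm.sum_comp]
  simpa using hx i

/-- Complementary slackness: an optimal `w` has a dual solution. -/
lemma dual_exists {δ : Type} [Fintype δ] {ι : Type} [Fintype ι] (v : ι → δ → ℝ) (c : ι → ℝ)
    (w : ι → ℝ) (hw : ∀ i, 0 ≤ w i)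
    (hopt : ∀ w' : ι → ℝ, (∀ i, 0 ≤ w' i) → (∀ l, ∑ i, w' i * v i l = ∑ i, w i * v i l) →
      ∑ i, w i * c i ≤ ∑ i, w' i * c i) :
    ∃ x : δ → ℝ, (∀ i, ∑ l, v i l * x l ≤ c i) ∧ ∀ i, 0 < w i → ∑ l, v i l * x l = c i := by
  let σ : ι × Bool → ℝ := fun q => if q.2 then 1 else if 0 < w q.1 then -1 else 0
  obtain ⟨x, hx⟩ := farkas_type (ι := ι × Bool) (fun q l => σ q * v q.1 l)
    (fun q => σ q * c q.1) (by
      intro μ hμ hz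
      let ν : ι → ℝ := fun i => ∑ b, μ (i, b) * σ (i, b)
      have key : ∀ u : ι → ℝ, ∑ q, μ q * (σ q * u q.1) = ∑ i, ν i * u i := by
        intro u
        rw [Fintype.sum_prod_type]
        simp only [ν, Finset.sum_mul, mul_assoc]
      have hz' : ∀ l, ∑ i, ν i * v i l = 0 := fun l => by
        rw [← key (fun i => v i l)]; exact hz l
      rw [key]
      have hev : ∀ i, ∀ᶠ t : ℝ in nhdsWithin 0 (Set.Ioi 0), 0 ≤ w i + t * ν i := by
        intro i
        by_cases hi : 0 < w i
        · have hc : Filter.Tendsto (fun t : ℝ => w i + t * ν i) (nhdsWithin 0 (Set.Ioi 0))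
              (nhds (w i + 0 * ν i)) :=
            (Continuous.tendsto (by fun_prop) 0).mono_left nhdsWithin_le_nhds
          have : (0 : ℝ) < w i + 0 * ν i := by simpa using hi
          exact (hc.eventually (lt_mem_nhds this)).mono fun t ht => le_of_lt ht
        · filter_upwards [self_mem_nhdsWithin] with t ht
          have : 0 ≤ ν i := by
            simp [ν, σ, hi, hμ]
          have ht' : 0 ≤ t := le_of_lt ht
          have := mul_nonneg ht' this
          linarith [hw i]
      obtain ⟨t, ht, htpos⟩ := ((Filter.eventually_all.2 hev).and self_mem_nhdsWithin).exists
      have hadd : ∀ u : ι → ℝ, ∑ i, (w i + t * ν i) * u i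
          = ∑ i, w i * u i + t * ∑ i, ν i * u i := by
        intro u
        simp only [add_mul, Finset.sum_add_distrib, Finset.mul_sum, mul_assoc]
      have := hopt (fun i => w i + t * ν i) ht (fun l => by
        rw [hadd (fun i => v i l), hz' l]; ring)
      rw [hadd] at this
      have htpos' : 0 < t := htpos
      have h0 : 0 ≤ t * ∑ i, ν i * c i := by linarith
      exact nonneg_of_mul_nonneg_right h0 htpos')
  have h1 : ∀ i, ∑ l, v i l * x l ≤ c i := fun i => by simpa [σ] using hx (i, true)
  refine ⟨x, h1, fun i hi => le_antisymm (h1 i) ?_⟩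
  have := hx (i, false)
  simp [σ, hi] at this
  exact this

/-- Feasible pairs: a fractional combination of monomials whose sum is the integral point `p`. -/
def FeasSet {n k : ℕ} {ι : Type} [Fintype ι] (e : ι → Exp n) (r : ι → Fin k) (L : ℝ) :
    Set (Exp n × (ι → ℝ)) :=
  {z | (∀ i, 0 ≤ z.2 i) ∧ (∀ j, ∑ i, z.2 i * (if r i = j then 1 else 0) = L) ∧
    ∀ l, ∑ i, z.2 i * (e i l : ℝ) = z.1 l}

lemma feas_le {n k : ℕ} {ι : Type} [Fintype ι] {e : ι → Exp n} {r : ι → Fin k} {L : ℝ}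
    {z : Exp n × (ι → ℝ)} (hz : z ∈ FeasSet e r L) (i : ι) : z.2 i ≤ L := by
  rw [← hz.2.1 (r i)]
  refine le_trans (le_of_eq ?_) (Finset.single_le_sum (f := fun i' => z.2 i' * (if r i' = r i then (1 : ℝ) else 0)) ?_ (Finset.mem_univ i))
  · simp
  · intro i' _
    have := hz.1 i'
    split_ifs <;> simp [this]

lemma feas_compact {n k : ℕ} {ι : Type} [Fintype ι] (e : ι → Exp n) (r : ι → Fin k) (L : ℕ) :
    IsCompact (FeasSet e r (L : ℝ)) := by
  have hK : IsCompact ((Set.Iic (fun l => ∑ i, L * e i l) : Set (Exp n)) ×ˢ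
      (Set.Icc (fun _ => 0) (fun _ => (L : ℝ)) : Set (ι → ℝ))) :=
    (Set.finite_Iic _).isCompact.prod isCompact_Icc
  refine hK.of_isClosed_subset ?_ ?_
  · have hcast : Continuous (fun m : ℕ => (m : ℝ)) := continuous_of_discreteTopology
    simp only [FeasSet, Set.ofPred_and, Set.ofPred_forall]
    refine IsClosed.inter (isClosed_iInter fun i => isClosed_le (by fun_prop) (by fun_prop))
      (IsClosed.inter (isClosed_iInter fun i => isClosed_eq (by fun_prop) (by fun_prop))
      (isClosed_iInter fun i => isClosed_eq (by fun_prop) ?_))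
    exact hcast.comp ((continuous_apply i).comp continuous_fst)
  · intro z hz
    refine ⟨fun l => ?_, fun i => hz.1 i, fun i => feas_le hz i⟩
    have h3 := hz.2.2 l
    have : (z.1 l : ℝ) ≤ ((∑ i, L * e i l : ℕ) : ℝ) := by
      rw [← h3]
      push_cast
      exact Finset.sum_le_sum fun i _ => mul_le_mul_of_nonneg_right (feas_le hz i) (by positivity)
    exact_mod_cast this

/-- The core of the argument. -/
lemma core_lemma {n k : ℕ} {ι : Type} [Fintype ι] (e : ι → Exp n) (c : ι → ℝ) (r : ι → Fin k)
    (s : ι → Bool) (hr : ∀ j, ∃ i, r i = j) (y : Exp n → ℝ)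
    (hy : ∀ i p, e i ≤ p → ∃ i', r i' = r i ∧ s i' = !s i ∧
      c i' + y (p - e i + e i') ≤ c i + y p) :
    ∃ (a : Fin n → ℝ) (b : Fin k → ℝ), (∀ i, b (r i) ≤ c i + ∑ l, (e i l : ℝ) * a l) ∧
      ∀ j t, ∃ i, r i = j ∧ s i = t ∧ b j = c i + ∑ l, (e i l : ℝ) * a l := by
  let L : ℕ := Fintype.card ι + 1
  let Ψ : Exp n × (ι → ℝ) → ℝ := fun z => y z.1 + ∑ i, z.2 i * c i
  have hΨ : Continuous Ψ := by
    have hyc : Continuous y := continuous_of_discreteTopology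
    exact (hyc.comp continuous_fst).add (by fun_prop)
  have hne : (FeasSet e r (L : ℝ)).Nonempty := by
    choose g hg using hr
    refine ⟨(fun l => ∑ j, L * e (g j) l, fun i => if g (r i) = i then (L : ℝ) else 0), ?_, ?_, ?_⟩
    · intro i; dsimp only; split_ifs <;> positivity
    · intro j
      rw [Finset.sum_eq_single (g j)]
      · simp [hg]
      · intro i _ hi
        dsimp only
        split_ifs with h1 h2
        · exact absurd (by rw [← h1, h2]) hi
        all_goals simp
      · simp
    · intro l
      push_cast
      have : ∀ i, (if g (r i) = i then (L : ℝ) else 0) * (e i l : ℝ)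
          = ∑ j, if g j = i then (L : ℝ) * (e i l : ℝ) else 0 := by
        intro i
        rw [Finset.sum_eq_single (r i)]
        · split_ifs <;> simp
        · intro j _ hj
          rw [if_neg]
          intro h
          exact hj (by rw [← h, hg])
        · simp
      simp only [this]
      rw [Finset.sum_comm]
      simp
  obtain ⟨z0, hz0, hmin0⟩ := (feas_compact e r L).exists_isMinOn hne hΨ.continuousOn
  have hstep : ∀ T : Finset (Fin k), ∃ z ∈ FeasSet e r (L : ℝ),
      (∀ z' ∈ FeasSet e r (L : ℝ), Ψ z ≤ Ψ z') ∧
      ∀ j ∈ T, ∀ t, ∃ i, r i = j ∧ s i = t ∧ 0 < z.2 i := by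
    intro T
    induction T using Finset.induction_on with
    | empty => exact ⟨z0, hz0, fun z' hz' => hmin0 hz', by simp⟩
    | insert j T hj ih =>
      obtain ⟨z, hz, hmin, hT⟩ := ih
      obtain ⟨i, hij, hi⟩ : ∃ i, r i = j ∧ 1 < z.2 i := by
        by_contra hcon
        push Not at hcon
        have h2 := hz.2.1 j
        have : ∑ i, z.2 i * (if r i = j then (1 : ℝ) else 0) ≤ ∑ i : ι, (1 : ℝ) := by
          apply Finset.sum_le_sum
          intro i _
          split_ifs with h
          · simpa using hcon i h
          · simp
        rw [h2] at this
        simp [L] at this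
        linarith
      have hle : e i ≤ z.1 := by
        intro l
        have h3 := hz.2.2 l
        have h4 : z.2 i * (e i l : ℝ) ≤ ∑ i', z.2 i' * (e i' l : ℝ) :=
          Finset.single_le_sum (f := fun i' => z.2 i' * (e i' l : ℝ))
            (fun i' _ => mul_nonneg (hz.1 i') (by positivity)) (Finset.mem_univ i)
        have h5 : (e i l : ℝ) ≤ z.1 l := by
          have : (0 : ℝ) ≤ e i l := by positivity
          nlinarith
        exact_mod_cast h5
      obtain ⟨i', hri', hsi', hyi'⟩ := hy i z.1 hle
      have hii' : i' ≠ i := by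
        rintro rfl
        cases h : s i' <;> simp [h] at hsi'
      let w : ι → ℝ := fun x => z.2 x - (if x = i then 1 else 0) + (if x = i' then 1 else 0)
      have hsum : ∀ u : ι → ℝ, ∑ x, w x * u x = ∑ x, z.2 x * u x - u i + u i' := by
        intro u
        simp only [w, add_mul, sub_mul, Finset.sum_add_distrib, Finset.sum_sub_distrib]
        simp
      have hwpos : ∀ x, 0 < z.2 x → 0 < w x := by
        intro x hx
        simp only [w]
        by_cases h : x = i
        · subst h
          simp [hii'.symm]; linarith
        · simp only [h, if_false]
          split_ifs <;> linarith
      have hwi' : 0 < w i' := by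
        have := hz.1 i'
        simp only [w, hii', if_false, if_true]; linarith
      have hfeas : (z.1 - e i + e i', w) ∈ FeasSet e r (L : ℝ) := by
        refine ⟨?_, ?_, ?_⟩
        · intro x
          rcases (hz.1 x).eq_or_lt with h | h
          · have hxi : x ≠ i := by rintro rfl; linarith
            simp only [w, hxi, if_false]
            split_ifs <;> linarith
          · exact (hwpos x h).le
        · intro j'
          dsimp only
          rw [hsum (fun x => if r x = j' then 1 else 0), hz.2.1 j', hri']
          ring
        · intro l
          dsimp only
          rw [hsum (fun x => (e x l : ℝ)), hz.2.2 l]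
          simp only [Pi.add_apply, Pi.sub_apply]
          rw [Nat.cast_add, Nat.cast_sub (hle l)]
      refine ⟨_, hfeas, ?_, ?_⟩
      · intro z' hz'
        refine le_trans ?_ (hmin z' hz')
        simp only [Ψ]
        rw [hsum c]
        linarith
      · intro j' hj' t
        rcases Finset.mem_insert.1 hj' with h | h
        · subst h
          by_cases hst : s i = t
          · exact ⟨i, hij, hst, hwpos i (by linarith)⟩
          · refine ⟨i', by rw [hri', hij], ?_, hwi'⟩
            rw [hsi']
            cases h1 : s i <;> cases t <;> simp_all
        · obtain ⟨x, hx1, hx2, hx3⟩ := hT j' h t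
          exact ⟨x, hx1, hx2, hwpos x hx3⟩
  obtain ⟨z, hz, hmin, hsupp⟩ := hstep Finset.univ
  let v : ι → (Fin n ⊕ Fin k) → ℝ := fun i =>
    Sum.elim (fun l => -(e i l : ℝ)) (fun j => if r i = j then 1 else 0)
  obtain ⟨x, hx1, hx2⟩ := dual_exists v c z.2 hz.1 (by
    intro w' hw' hl
    have := hmin (z.1, w') ⟨hw', fun j => by
      have := hl (Sum.inr j)
      simp only [v, Sum.elim_inr] at this
      dsimp only
      rw [this, hz.2.1 j], fun l => by
      have := hl (Sum.inl l)
      simp only [v, Sum.elim_inl, mul_neg, Finset.sum_neg_distrib, neg_inj] at this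
      dsimp only
      rw [this, hz.2.2 l]⟩
    simp only [Ψ] at this
    linarith)
  have hval : ∀ i, ∑ l, v i l * x l =
      x (Sum.inr (r i)) - ∑ l, (e i l : ℝ) * x (Sum.inl l) := by
    intro i
    rw [Fintype.sum_sum_type]
    simp [v]
    ring
  refine ⟨fun l => x (Sum.inl l), fun j => x (Sum.inr j), ?_, ?_⟩
  · intro i
    have := hx1 i
    rw [hval] at this
    linarith
  · intro j t
    obtain ⟨i, hi1, hi2, hi3⟩ := hsupp j (Finset.mem_univ _) t
    refine ⟨i, hi1, hi2, ?_⟩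
    have := hx2 i hi3
    rw [hval, hi1] at this
    linarith

/-- The two members of a pair. -/
def sidePoly {n k : ℕ} (F : Fin k → TropPoly n × TropPoly n) (j : Fin k) (t : Bool) :
    TropPoly n := if t then (F j).1 else (F j).2

lemma macMinInf_coe {n : ℕ} (f : TropPoly n) (J : Exp n) (y : Exp n → ℝ) :
    macMinInf f J (fun I => (y I : WithTop ℝ)) =
      ((f.supp.inf' f.supp_nonempty (fun I => f.coeff I + y (J + I)) : ℝ) : WithTop ℝ) := by
  rw [Finset.coe_inf']
  rfl

/-- **Infinite min-plus dual Nullstellensatz over ℝ** : a system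
`F = {(f_1,g_1), …, (f_k,g_k)}` of min-plus polynomials in `n` variables over `ℝ` has a
root iff the infinite Macaulay min-plus linear system of `F` has a solution. -/
theorem minplus_dual_nullstellensatz_infinite (n k : ℕ) (hk : 1 ≤ k)
    (F : Fin k → TropPoly n × TropPoly n) :
    (∃ a : Fin n → ℝ, ∀ j : Fin k, (F j).1.eval a = (F j).2.eval a) ↔
      (∃ y : Exp n → ℝ, IsMPInfMacaulaySol F y) := by
  constructor
  · rintro ⟨a, ha⟩
    refine ⟨fun I => ∑ l, (I l : ℝ) * a l, fun j J => ?_⟩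
    rw [macMinInf_coe, macMinInf_coe, WithTop.coe_inj]
    have key : ∀ f : TropPoly n, f.supp.inf' f.supp_nonempty
        (fun I => f.coeff I + ∑ l, ((J + I) l : ℝ) * a l)
          = f.eval a + ∑ l, (J l : ℝ) * a l := by
      intro f
      have h1 : ∀ I, f.coeff I + ∑ l, (((J + I) l : ℕ) : ℝ) * a l
          = f.mono I a + ∑ l, (J l : ℝ) * a l := by
        intro I
        simp only [TropPoly.mono, Pi.add_apply, Nat.cast_add, add_mul, Finset.sum_add_distrib]
        ring
      simp only [h1, TropPoly.eval]
      apply le_antisymm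
      · obtain ⟨I, hI, hI'⟩ := Finset.exists_mem_eq_inf' f.supp_nonempty (fun I => f.mono I a)
        rw [hI']
        exact Finset.inf'_le _ hI
      · apply Finset.le_inf'
        intro I hI
        have := Finset.inf'_le (fun I => f.mono I a) hI
        linarith
    rw [key, key, ha]
  · rintro ⟨y, hy⟩
    have hy' : ∀ j t J, (sidePoly F j t).supp.inf' (sidePoly F j t).supp_nonempty
          (fun I => (sidePoly F j t).coeff I + y (J + I)) =
        (sidePoly F j (!t)).supp.inf' (sidePoly F j (!t)).supp_nonempty
          (fun I => (sidePoly F j (!t)).coeff I + y (J + I)) := by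
      intro j t J
      have := hy j J
      rw [macMinInf_coe, macMinInf_coe, WithTop.coe_inj] at this
      cases t
      · exact this.symm
      · exact this
    let ι : Type := Σ q : Fin k × Bool, {I // I ∈ (sidePoly F q.1 q.2).supp}
    obtain ⟨a, b, h1, h2⟩ := core_lemma (ι := ι) (fun i => i.2.1)
      (fun i => (sidePoly F i.1.1 i.1.2).coeff i.2.1) (fun i => i.1.1) (fun i => i.1.2)
      (by
        intro j
        obtain ⟨I, hI⟩ := (sidePoly F j true).supp_nonempty
        exact ⟨⟨(j, true), ⟨I, hI⟩⟩, rfl⟩) y (by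
        rintro ⟨⟨j, t⟩, ⟨I, hI⟩⟩ p hp
        obtain ⟨I', hI', hI''⟩ := Finset.exists_mem_eq_inf' (sidePoly F j (!t)).supp_nonempty
          (fun I' => (sidePoly F j (!t)).coeff I' + y (p - I + I'))
        refine ⟨⟨(j, !t), ⟨I', hI'⟩⟩, rfl, rfl, ?_⟩
        dsimp only at hp ⊢
        rw [← hI'', ← hy' j t (p - I)]
        have := Finset.inf'_le (fun I' => (sidePoly F j t).coeff I' + y (p - I + I')) hI
        dsimp only at this
        rwa [tsub_add_cancel_of_le hp] at this)
    have hb : ∀ j t, (sidePoly F j t).eval a = b j := by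
      intro j t
      apply le_antisymm
      · obtain ⟨⟨⟨j', t'⟩, ⟨I, hI⟩⟩, hr, hs, he⟩ := h2 j t
        dsimp only at hr hs he hI
        subst hr hs
        rw [he]
        exact Finset.inf'_le (fun I => (sidePoly F j' t').mono I a) hI
      · apply Finset.le_inf'
        intro I hI
        exact h1 ⟨(j, t), ⟨I, hI⟩⟩
    exact ⟨a, fun j => (hb j true).trans (hb j false).symm⟩
end

section
/- Let F = {(f_1, g_1), …, (f_k, g_k)} (k ≥ 1) be a system of min-plus polynomials in n variables over ℝ, let d_j = max(deg f_j, deg g_j), and set N = (n+2)(d_1 + ⋯ + d_k). Then F has no root in ℝ^n if and only if there exists a min-plus algebraic combination (f, g) of F of degree at most N such that for every exponent vector I ∈ ℕ^n with |I| ≤ N, either f_I = g_I = +∞, or g_I is finite and g_I < f_I (where +∞ counts as greater than every real). -/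
open scoped Classical

/-- The data of a min-plus algebraic combination of a system of `k` min-plus polynomials
in `n` variables: a finite nonempty list of tuples `(c_l, J_l, i_l, ε_l)` where `ε_l`
records whether the pair `(f_{i_l}, g_{i_l})` is used swapped. -/
structure MPComb (n k : ℕ) where
  K : ℕ
  K_pos : 0 < K
  c : Fin K → ℝ
  J : Fin K → Exp n
  idx : Fin K → Fin k
  flip : Fin K → Bool

/-- The left polynomial `p_l` associated to the `l`-th tuple. -/
def MPComb.p {n k : ℕ} (comb : MPComb n k) (F : Fin k → TropPoly n × TropPoly n)
    (l : Fin comb.K) : TropPoly n :=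
  if comb.flip l then (F (comb.idx l)).2 else (F (comb.idx l)).1

/-- The right polynomial `q_l` associated to the `l`-th tuple. -/
def MPComb.q {n k : ℕ} (comb : MPComb n k) (F : Fin k → TropPoly n × TropPoly n)
    (l : Fin comb.K) : TropPoly n :=
  if comb.flip l then (F (comb.idx l)).1 else (F (comb.idx l)).2

/-- The coefficient `f_I = min_l (c_l + c_{p_l}(I - J_l))` of the left-hand side of the
combination. -/
noncomputable def MPComb.fCoeff {n k : ℕ} (comb : MPComb n k)
    (F : Fin k → TropPoly n × TropPoly n) (I : Exp n) : WithTop ℝ :=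
  Finset.univ.inf (fun l : Fin comb.K =>
    (comb.c l : WithTop ℝ) + shiftCoeff (comb.p F l) (comb.J l) I)

/-- The coefficient `g_I = min_l (c_l + c_{q_l}(I - J_l))` of the right-hand side of the
combination. -/
noncomputable def MPComb.gCoeff {n k : ℕ} (comb : MPComb n k)
    (F : Fin k → TropPoly n × TropPoly n) (I : Exp n) : WithTop ℝ :=
  Finset.univ.inf (fun l : Fin comb.K =>
    (comb.c l : WithTop ℝ) + shiftCoeff (comb.q F l) (comb.J l) I)

/-- The combination has degree at most `N`. -/
def MPComb.DegLE {n k : ℕ} (comb : MPComb n k) (F : Fin k → TropPoly n × TropPoly n)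
    (N : ℕ) : Prop :=
  ∀ l : Fin comb.K,
    expDeg (comb.J l) + max (F (comb.idx l)).1.deg (F (comb.idx l)).2.deg ≤ N

theorem mp_farkas_fin {V : Type*} [AddCommGroup V] [Module ℝ V] (m : ℕ) :
    ∀ (g : Fin m → V →ₗ[ℝ] ℝ) (f : V →ₗ[ℝ] ℝ),
      (∀ x, (∀ i, 0 ≤ g i x) → 0 ≤ f x) →
      ∃ c : Fin m → ℝ, (∀ i, 0 ≤ c i) ∧ f = ∑ i, c i • g i := by
  induction m with
  | zero =>
    intro g f h
    refine ⟨fun _ => 0, fun i => i.elim0, ?_⟩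
    ext x
    have h1 := h x (fun i => i.elim0)
    have h2 := h (-x) (fun i => i.elim0)
    simp at h2 ⊢
    linarith
  | succ m ih =>
    intro g f h
    by_cases hc : ∀ x, (∀ i : Fin m, 0 ≤ g i.succ x) → 0 ≤ f x
    · obtain ⟨c, hc0, hc1⟩ := ih (fun i => g i.succ) f hc
      refine ⟨Fin.cons 0 c, ?_, ?_⟩
      · intro i
        refine Fin.cases ?_ ?_ i
        · simp
        · intro i; simpa using hc0 i
      · rw [Fin.sum_univ_succ]; simpa using hc1
    · push Not at hc
      obtain ⟨u, hu, hfu⟩ := hc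
      have hg0 : g 0 u < 0 := by
        by_contra hcon
        push Not at hcon
        have := h u (fun i => by
          refine Fin.cases hcon (fun i => hu i) i)
        linarith
      obtain ⟨c, hc0, hc1⟩ := ih (fun i => g i.succ - (g i.succ u / g 0 u) • g 0)
        (f - (f u / g 0 u) • g 0) (by
          intro x hx
          have := h (x - (g 0 x / g 0 u) • u) (by
            intro i
            refine Fin.cases ?_ (fun i => ?_) i
            · simp [div_mul_cancel₀ _ hg0.ne]
            · have := hx i
              simp at this ⊢
              exact le_trans (le_of_eq (by ring)) this)
          simp at this ⊢
          exact le_trans (le_of_eq (by ring)) this)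
      refine ⟨Fin.cons (f u / g 0 u - ∑ i, c i * (g i.succ u / g 0 u)) c, ?_, ?_⟩
      · intro i
        refine Fin.cases ?_ (fun i => by simpa using hc0 i) i
        have h1 : 0 < f u / g 0 u := div_pos_of_neg_of_neg hfu hg0
        have h2 : ∑ i, c i * (g i.succ u / g 0 u) ≤ 0 :=
          Finset.sum_nonpos (fun i _ => mul_nonpos_of_nonneg_of_nonpos (hc0 i)
            (div_nonpos_of_nonneg_of_nonpos (hu i) hg0.le))
        simp only [Fin.cons_zero]; linarith
      · rw [Fin.sum_univ_succ]
        simp only [Fin.cons_zero, Fin.cons_succ]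
        ext x
        have := LinearMap.congr_fun hc1 x
        simp [mul_sub, Finset.sum_sub_distrib] at this ⊢
        have e : ∑ i, c i * (g i.succ u / g 0 u * g 0 x)
          = (∑ i, c i * (g i.succ u / g 0 u)) * g 0 x := by
          rw [Finset.sum_mul]; exact Finset.sum_congr rfl (fun i _ => by ring)
        rw [e] at this
        linarith

theorem mp_farkas {V τ : Type*} [AddCommGroup V] [Module ℝ V] [Fintype τ]
    (g : τ → V →ₗ[ℝ] ℝ) (f : V →ₗ[ℝ] ℝ)
    (h : ∀ x, (∀ i, 0 ≤ g i x) → 0 ≤ f x) :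
    ∃ c : τ → ℝ, (∀ i, 0 ≤ c i) ∧ f = ∑ i, c i • g i := by
  obtain ⟨c, h0, h1⟩ := mp_farkas_fin _ (fun i => g ((Fintype.equivFin τ).symm i)) f
    (fun x hx => h x (fun i => by simpa using hx (Fintype.equivFin τ i)))
  refine ⟨fun i => c (Fintype.equivFin τ i), fun i => h0 _, ?_⟩
  rw [h1]
  exact Fintype.sum_equiv (Fintype.equivFin τ).symm _ _ (fun i => by simp)

/-- Optimal solutions of the transport problem admit dual multipliers. -/
theorem mp_lp_dual {ι κ : Type*} [Fintype ι] [Fintype κ] [DecidableEq κ] {n : ℕ} (blk : ι → κ)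
    (pt : ι → Fin n → ℝ) (h : ι → ℝ) (w : ι → ℝ) (hw : ∀ i, 0 ≤ w i)
    (hopt : ∀ w' : ι → ℝ, (∀ i, 0 ≤ w' i) →
      (∀ j, ∑ i, (if blk i = j then w' i else 0) = ∑ i, (if blk i = j then w i else 0)) →
      (∀ t, ∑ i, w' i * pt i t = ∑ i, w i * pt i t) →
      ∑ i, w i * h i ≤ ∑ i, w' i * h i) :
    ∃ (x : Fin n → ℝ) (μ : κ → ℝ), ∀ i, μ (blk i) ≤ h i + ∑ t, pt i t * x t ∧
      (0 < w i → h i + ∑ t, pt i t * x t = μ (blk i)) := by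
  let pr : ι → (ι → ℝ) →ₗ[ℝ] ℝ := fun i => LinearMap.proj i
  let B : κ → (ι → ℝ) →ₗ[ℝ] ℝ := fun j => ∑ i, (if blk i = j then pr i else 0)
  let Q : Fin n → (ι → ℝ) →ₗ[ℝ] ℝ := fun t => ∑ i, pt i t • pr i
  let H : (ι → ℝ) →ₗ[ℝ] ℝ := ∑ i, h i • pr i
  let Z : ι → (ι → ℝ) →ₗ[ℝ] ℝ := fun i => if w i = 0 then pr i else 0
  have hB : ∀ j d, B j d = ∑ i, (if blk i = j then d i else 0) := by
    intro j d
    simp only [B, LinearMap.sum_apply]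
    exact Finset.sum_congr rfl (fun i _ => by split_ifs <;> simp [pr])
  have hQ : ∀ t d, Q t d = ∑ i, d i * pt i t := by
    intro j d
    simp only [Q, LinearMap.sum_apply]
    exact Finset.sum_congr rfl (fun i _ => by simp [pr, mul_comm])
  have hH : ∀ d, H d = ∑ i, d i * h i := by
    intro d
    simp only [H, LinearMap.sum_apply]
    exact Finset.sum_congr rfl (fun i _ => by simp [pr, mul_comm])
  have hZ : ∀ i d, Z i d = if w i = 0 then d i else 0 := by
    intro i d
    simp only [Z]; split_ifs <;> simp [pr]
  let G : (ι ⊕ ((κ ⊕ κ) ⊕ (Fin n ⊕ Fin n))) → (ι → ℝ) →ₗ[ℝ] ℝ :=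
    Sum.elim Z (Sum.elim (Sum.elim B (fun j => - B j)) (Sum.elim Q (fun t => - Q t)))
  obtain ⟨c, hc0, hc1⟩ := mp_farkas G H (by
    intro d hd
    have d1 : ∀ i, w i = 0 → 0 ≤ d i := by
      intro i hi
      have := hd (Sum.inl i)
      simpa [G, hZ, hi] using this
    have d2 : ∀ j, B j d = 0 := by
      intro j
      have h1 := hd (Sum.inr (Sum.inl (Sum.inl j)))
      have h2 := hd (Sum.inr (Sum.inl (Sum.inr j)))
      simp [G] at h1 h2
      linarith
    have d3 : ∀ j, Q j d = 0 := by
      intro j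
      have h1 := hd (Sum.inr (Sum.inr (Sum.inl j)))
      have h2 := hd (Sum.inr (Sum.inr (Sum.inr j)))
      simp [G] at h1 h2
      linarith
    have hev : ∀ i, ∀ᶠ ε in nhdsWithin (0:ℝ) (Set.Ioi 0), 0 ≤ w i + ε * d i := by
      intro i
      rcases (hw i).eq_or_lt with h0 | h0
      · filter_upwards [self_mem_nhdsWithin] with ε hε
        have hε' : (0:ℝ) < ε := hε
        rw [← h0]
        have := d1 i h0.symm
        positivity
      · have : Filter.Tendsto (fun ε : ℝ => w i + ε * d i) (nhdsWithin (0:ℝ) (Set.Ioi 0))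
            (nhds (w i + 0 * d i)) := by
          apply Filter.Tendsto.mono_left _ nhdsWithin_le_nhds
          apply Continuous.tendsto
          fun_prop
        filter_upwards [this.eventually (lt_mem_nhds (by simpa using h0))] with ε hε
        exact hε.le
    obtain ⟨ε, hε, hεpos⟩ := ((Filter.eventually_all.2 hev).and self_mem_nhdsWithin).exists
    have hεpos' : (0:ℝ) < ε := hεpos
    have key := hopt (fun i => w i + ε * d i) hε (by
      intro j
      have := d2 j
      rw [hB] at this
      have e : ∀ i, (if blk i = j then w i + ε * d i else 0)
        = (if blk i = j then w i else 0) + ε * (if blk i = j then d i else 0) := by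
        intro i; split_ifs <;> simp
      simp only [e, Finset.sum_add_distrib, ← Finset.mul_sum, this]
      simp) (by
      intro t
      have := d3 t
      rw [hQ] at this
      simp only [add_mul, mul_assoc, Finset.sum_add_distrib, ← Finset.mul_sum, this]
      simp)
    simp only [add_mul, mul_assoc, Finset.sum_add_distrib, ← Finset.mul_sum] at key
    rw [hH]
    have : 0 ≤ ε * ∑ i, d i * h i := by linarith
    exact nonneg_of_mul_nonneg_right this hεpos')
  refine ⟨fun t => -(c (Sum.inr (Sum.inr (Sum.inl t))) - c (Sum.inr (Sum.inr (Sum.inr t)))),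
    fun j => c (Sum.inr (Sum.inl (Sum.inl j))) - c (Sum.inr (Sum.inl (Sum.inr j))), ?_⟩
  intro i
  have key := LinearMap.congr_fun hc1 (Pi.single i 1)
  simp only [Fintype.sum_sum_type, G, Sum.elim_inl, Sum.elim_inr] at key
  simp only [LinearMap.add_apply, LinearMap.sum_apply, LinearMap.smul_apply,
    hH, hB, hQ, hZ, LinearMap.neg_apply, smul_eq_mul] at key
  have e0 : ∑ a, (Pi.single i (1:ℝ) : ι → ℝ) a * h a = h i := by
    simp [Pi.single_apply]
  have e1 : ∀ j, ∑ a, (if blk a = j then (Pi.single i (1:ℝ) : ι → ℝ) a else 0)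
      = if blk i = j then 1 else 0 := by
    intro j
    rw [Finset.sum_eq_single i]
    · simp
    · intro a _ ha; simp [ha]
    · simp
  have e2 : ∀ t, ∑ a, (Pi.single i (1:ℝ) : ι → ℝ) a * pt a t = pt i t := by
    intro t; simp [Pi.single_apply]
  have e3 : ∑ a, c (Sum.inl a) * (if w a = 0 then (Pi.single i (1:ℝ) : ι → ℝ) a else 0)
      = if w i = 0 then c (Sum.inl i) else 0 := by
    rw [Finset.sum_eq_single i]
    · simp
    · intro a _ ha; simp [ha]
    · simp
  rw [e0, e3] at key
  simp only [e1, e2] at key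
  simp at key
  have e4 : ∑ t, pt i t * -(c (Sum.inr (Sum.inr (Sum.inl t))) - c (Sum.inr (Sum.inr (Sum.inr t))))
     = -(∑ t, c (Sum.inr (Sum.inr (Sum.inl t))) * pt i t) + 
       ∑ t, c (Sum.inr (Sum.inr (Sum.inr t))) * pt i t := by
    rw [← Finset.sum_neg_distrib, ← Finset.sum_add_distrib]
    exact Finset.sum_congr rfl (fun t _ => by ring)
  rw [e4]
  have := hc0 (Sum.inl i)
  constructor
  · split_ifs at key <;> linarith
  · intro hpos
    rw [if_neg hpos.ne'] at key
    linarith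

/-- A Caratheodory type reduction: total mass `n+2` in dimension `n` can be redistributed so that
some atom has mass at least one. -/
theorem mp_carath {ι : Type*} [Fintype ι] {n : ℕ} (pt : ι → Fin n → ℝ) (w : ι → ℝ)
    (hw : ∀ i, 0 ≤ w i) (hsum : ∑ i, w i = n + 2) :
    ∃ w' : ι → ℝ, (∀ i, 0 ≤ w' i) ∧ (∀ i, 0 < w' i → 0 < w i) ∧ ∑ i, w' i = n + 2 ∧
      (∀ t, ∑ i, w' i * pt i t = ∑ i, w i * pt i t) ∧ ∃ i, 1 ≤ w' i := by
  have hn : (0:ℝ) < n + 2 := by positivity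
  let s : Set (Fin n → ℝ) := Set.image pt {i | 0 < w i}
  have hx : (∑ i, (w i / (n+2)) • pt i) ∈ convexHull ℝ s := by
    have hs : ∑ i, (w i / (n+2)) • pt i
        = ∑ i ∈ Finset.univ.filter (fun i => 0 < w i), (w i / (n+2)) • pt i := by
      symm
      apply Finset.sum_subset (Finset.subset_univ _)
      intro i _ hi
      have : w i = 0 := by
        have := hw i
        simp at hi
        linarith
      simp [this]
    rw [hs]
    apply (convex_convexHull ℝ s).sum_mem
    · intro i _; exact div_nonneg (hw i) hn.le
    · rw [← Finset.sum_div, div_eq_one_iff_eq hn.ne', ← hsum]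
      apply Finset.sum_subset (Finset.subset_univ _)
      intro i _ hi
      have := hw i
      simp at hi
      linarith
    · intro i hi
      apply subset_convexHull
      exact ⟨i, by simpa using hi, rfl⟩
  obtain ⟨τ, _, z, v, hz, haff, hv, hv1, hvz⟩ := eq_pos_convex_span_of_mem_convexHull hx
  have hzz : ∀ t, ∃ i, 0 < w i ∧ pt i = z t := by
    intro t
    obtain ⟨i, hi, hi2⟩ := hz ⟨t, rfl⟩
    exact ⟨i, hi, hi2⟩
  choose g hg1 hg2 using hzz
  have hcard : Fintype.card τ ≤ n + 1 := by
    have := haff.card_le_finrank_succ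
    refine this.trans ?_
    have h2 := Submodule.finrank_le (vectorSpan ℝ (Set.range z))
    simp at h2
    omega
  have hmax : ∃ t, 1 ≤ (n+2) * v t := by
    by_contra hcon
    push Not at hcon
    have h1 : ∑ t, (n+2) * v t ≤ ∑ t : τ, (1:ℝ) := Finset.sum_le_sum (fun t _ => (hcon t).le)
    rw [← Finset.mul_sum, hv1] at h1
    simp at h1
    have : (Fintype.card τ : ℝ) ≤ n + 1 := by exact_mod_cast hcard
    linarith
  have hsw : ∀ a : ι → ℝ, ∑ i, (∑ t, if g t = i then ((n:ℝ)+2) * v t else 0) * a i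
      = (n+2) * ∑ t, v t * a (g t) := by
    intro a
    simp only [Finset.sum_mul]
    rw [Finset.sum_comm, Finset.mul_sum]
    apply Finset.sum_congr rfl
    intro t _
    simp [ite_mul, mul_assoc]
  refine ⟨fun i => ∑ t, if g t = i then ((n:ℝ)+2) * v t else 0, ?_, ?_, ?_, ?_, ?_⟩
  · intro i
    apply Finset.sum_nonneg
    intro t _
    have := hv t
    split_ifs <;> positivity
  · intro i hi
    obtain ⟨t, _, ht⟩ := Finset.exists_ne_zero_of_sum_ne_zero hi.ne'
    have : g t = i := by by_contra hne; simp [hne] at ht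
    rw [← this]; exact hg1 t
  · have := hsw (fun _ => 1)
    simpa [hv1] using this
  · intro t
    rw [hsw (fun i => pt i t)]
    have h1 := congrFun hvz t
    simp only [Finset.sum_apply, Pi.smul_apply, smul_eq_mul] at h1
    simp only [hg2]
    rw [h1, Finset.mul_sum]
    exact Finset.sum_congr rfl (fun i _ => by field_simp)
  · obtain ⟨t, ht⟩ := hmax
    refine ⟨g t, ht.trans ?_⟩
    have := Finset.single_le_sum (f := fun t' => if g t' = g t then ((n:ℝ)+2) * v t' else 0)
      (s := Finset.univ) (fun t' _ => by have := hv t'; split_ifs <;> positivity)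
      (Finset.mem_univ t)
    simpa using this

/-- The polynomial of the system on side `s.2` of the pair `s.1`. -/
def mpP {n k : ℕ} (F : Fin k → TropPoly n × TropPoly n) (s : Fin k × Bool) : TropPoly n :=
  if s.2 then (F s.1).2 else (F s.1).1

/-- Atoms: a monomial together with the pair and the side where it occurs. -/
abbrev MPAtom {n k : ℕ} (F : Fin k → TropPoly n × TropPoly n) : Type :=
  (s : Fin k × Bool) × {v : Exp n // v ∈ (mpP F s).supp}

/-- Maximal degree of the `j`-th pair. -/
def mpD {n k : ℕ} (F : Fin k → TropPoly n × TropPoly n) (j : Fin k) : ℕ :=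
  max (F j).1.deg (F j).2.deg

theorem mpP_deg {n k : ℕ} (F : Fin k → TropPoly n × TropPoly n) (i : MPAtom F) :
    expDeg i.2.1 ≤ mpD F i.1.1 := by
  obtain ⟨⟨j, b⟩, v, hv⟩ := i
  have h1 : expDeg v ≤ (mpP F (j, b)).deg := Finset.le_sup (f := expDeg) hv
  refine h1.trans ?_
  cases b <;> simp [mpP, mpD]

/-- Feasible weights above `I`. -/
structure MPFeas {n k : ℕ} (F : Fin k → TropPoly n × TropPoly n) (I : Exp n)
    (w : MPAtom F → ℝ) : Prop where
  nonneg : ∀ i, 0 ≤ w i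
  mass : ∀ j, ∑ i, (if i.1.1 = j then w i else 0) = (n : ℝ) + 2
  bary : ∀ t, ∑ i, w i * (i.2.1 t : ℝ) = (I t : ℝ)

/-- Cost of the weights. -/
def mpCost {n k : ℕ} (F : Fin k → TropPoly n × TropPoly n) (w : MPAtom F → ℝ) : ℝ :=
  ∑ i, w i * (mpP F i.1).coeff i.2.1

/-- Optimal weights above `I`. -/
def MPOpt {n k : ℕ} (F : Fin k → TropPoly n × TropPoly n) (I : Exp n)
    (w : MPAtom F → ℝ) : Prop :=
  MPFeas F I w ∧ ∀ wt, MPFeas F I wt → mpCost F w ≤ mpCost F wt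

/-- The pairs for which both sides are charged. -/
noncomputable def mpMixed {n k : ℕ} (F : Fin k → TropPoly n × TropPoly n)
    (w : MPAtom F → ℝ) : Finset (Fin k) :=
  Finset.univ.filter (fun j => ∀ b : Bool, ∃ i, 0 < w i ∧ i.1 = (j, b))

theorem mp_blk_sum {ι κ : Type*} [Fintype ι] [Fintype κ] [DecidableEq κ] (blk : ι → κ) (w : ι → ℝ) (μ : κ → ℝ) :
    ∑ i, w i * μ (blk i) = ∑ j, μ j * ∑ i, (if blk i = j then w i else 0) := by
  simp only [Finset.mul_sum]
  rw [Finset.sum_comm]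
  apply Finset.sum_congr rfl
  intro i _
  simp [mul_comm]

theorem mp_exists_opt {n k : ℕ} (F : Fin k → TropPoly n × TropPoly n) (I : Exp n)
    (h : ∃ w, MPFeas F I w) : ∃ w, MPOpt F I w := by
  have hcl : IsClosed {w : MPAtom F → ℝ | MPFeas F I w} := by
    have : {w : MPAtom F → ℝ | MPFeas F I w} =
        {w | ∀ i, 0 ≤ w i} ∩ ({w | ∀ j, ∑ i, (if i.1.1 = j then w i else 0) = (n : ℝ) + 2} ∩
          {w | ∀ t, ∑ i, w i * (i.2.1 t : ℝ) = (I t : ℝ)}) := by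
      ext w
      exact ⟨fun h => ⟨h.1, h.2, h.3⟩, fun h => ⟨h.1, h.2.1, h.2.2⟩⟩
    rw [this]
    refine IsClosed.inter ?_ (IsClosed.inter ?_ ?_)
    · simp only [Set.ofPred_forall]
      exact isClosed_iInter (fun i => isClosed_le continuous_const (continuous_apply i))
    · simp only [Set.ofPred_forall]
      refine isClosed_iInter (fun j => isClosed_eq ?_ continuous_const)
      refine continuous_finsetSum _ (fun i _ => ?_)
      split_ifs
      · exact continuous_apply i
      · exact continuous_const
    · simp only [Set.ofPred_forall]
      refine isClosed_iInter (fun j => isClosed_eq ?_ continuous_const)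
      fun_prop
  have hcomp : IsCompact {w : MPAtom F → ℝ | MPFeas F I w} := by
    refine (isCompact_Icc (a := fun _ : MPAtom F => (0:ℝ))
      (b := fun _ => (n:ℝ) + 2)).of_isClosed_subset hcl ?_
    intro w hw
    refine ⟨fun i => hw.nonneg i, fun i => ?_⟩
    rw [← hw.mass i.1.1]
    have := Finset.single_le_sum (f := fun i' => if i'.1.1 = i.1.1 then w i' else 0)
      (s := Finset.univ) (fun i' _ => by
        have := hw.nonneg i'
        split_ifs
        · exact this
        · exact le_rfl) (Finset.mem_univ i)
    simpa using this
  obtain ⟨w, hw, hmin⟩ := hcomp.exists_isMinOn h (f := mpCost F) (by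
    apply Continuous.continuousOn
    unfold mpCost
    fun_prop)
  exact ⟨w, hw, fun w' hw' => hmin hw'⟩

theorem mp_feas_deg {n k : ℕ} (F : Fin k → TropPoly n × TropPoly n) (I : Exp n)
    (w : MPAtom F → ℝ) (h : MPFeas F I w) : expDeg I ≤ (n + 2) * ∑ j, mpD F j := by
  have h1 : (expDeg I : ℝ) = ∑ i, w i * (expDeg i.2.1 : ℝ) := by
    simp only [expDeg, Nat.cast_sum, ← h.bary, Finset.mul_sum]
    rw [Finset.sum_comm]
  have h2 : ∑ i, w i * (expDeg i.2.1 : ℝ) ≤ ∑ i, w i * (mpD F i.1.1 : ℝ) :=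
    Finset.sum_le_sum (fun i _ => mul_le_mul_of_nonneg_left
      (by exact_mod_cast mpP_deg F i) (h.nonneg i))
  rw [mp_blk_sum (fun i : MPAtom F => i.1.1) w (fun j => (mpD F j : ℝ))] at h2
  simp only [h.mass] at h2
  rw [← Finset.sum_mul, ← h1] at h2
  have : (expDeg I : ℝ) ≤ (((n + 2) * ∑ j, mpD F j : ℕ) : ℝ) := by
    push_cast
    linarith
  exact_mod_cast this

theorem mp_le_of_one_le {n k : ℕ} (F : Fin k → TropPoly n × TropPoly n) (I : Exp n)
    (w : MPAtom F → ℝ) (h : MPFeas F I w) (i0 : MPAtom F) (h1 : 1 ≤ w i0) : i0.2.1 ≤ I := by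
  intro t
  have := Finset.single_le_sum (f := fun i : MPAtom F => w i * (i.2.1 t : ℝ))
    (s := Finset.univ) (fun i _ => mul_nonneg (h.nonneg i) (Nat.cast_nonneg _))
    (Finset.mem_univ i0)
  rw [h.bary] at this
  have h2 : (1:ℝ) * (i0.2.1 t : ℝ) ≤ w i0 * (i0.2.1 t : ℝ) :=
    mul_le_mul_of_nonneg_right h1 (Nat.cast_nonneg _)
  have h3 : ((i0.2.1 t : ℕ) : ℝ) ≤ (I t : ℝ) := by
    linarith
  exact_mod_cast h3

/-- Moving a unit of mass from `i0` to `i1`. -/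
noncomputable def mpMove {n k : ℕ} (F : Fin k → TropPoly n × TropPoly n)
    (w : MPAtom F → ℝ) (i0 i1 : MPAtom F) : MPAtom F → ℝ :=
  fun i => w i - (if i = i0 then 1 else 0) + (if i = i1 then 1 else 0)

theorem mpMove_sum {n k : ℕ} (F : Fin k → TropPoly n × TropPoly n)
    (w : MPAtom F → ℝ) (i0 i1 : MPAtom F) (a : MPAtom F → ℝ) :
    ∑ i, mpMove F w i0 i1 i * a i = ∑ i, w i * a i - a i0 + a i1 := by
  simp [mpMove, add_mul, sub_mul, Finset.sum_add_distrib, Finset.sum_sub_distrib]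

theorem mpMove_feas {n k : ℕ} (F : Fin k → TropPoly n × TropPoly n) (I : Exp n)
    (w : MPAtom F → ℝ) (h : MPFeas F I w) (i0 i1 : MPAtom F) (h1 : 1 ≤ w i0)
    (hb : i0.1.1 = i1.1.1) : MPFeas F (I - i0.2.1 + i1.2.1) (mpMove F w i0 i1) := by
  refine ⟨?_, ?_, ?_⟩
  · intro i
    have := h.nonneg i
    unfold mpMove
    by_cases hi : i = i0
    · subst hi
      split_ifs <;> simp at * <;> linarith
    · split_ifs <;> linarith
  · intro j
    have e := mpMove_sum F w i0 i1 (fun i => if i.1.1 = j then 1 else 0)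
    have e2 := h.mass j
    simp only [mul_ite, mul_one, mul_zero] at e
    rw [e, e2, hb]
    ring
  · intro t
    rw [mpMove_sum F w i0 i1 (fun i => (i.2.1 t : ℝ)), h.bary]
    have := mp_le_of_one_le F I w h i0 h1 t
    simp only [Pi.add_apply, Pi.sub_apply]
    push_cast [Nat.cast_sub this]
    ring

theorem mp_move_deg {n k : ℕ} (F : Fin k → TropPoly n × TropPoly n) (I : Exp n)
    (w : MPAtom F → ℝ) (h : MPFeas F I w) (i0 : MPAtom F) (h1 : 1 ≤ w i0) :
    expDeg (I - i0.2.1) + mpD F i0.1.1 ≤ (n + 2) * ∑ j, mpD F j := by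
  have hle := mp_le_of_one_le F I w h i0 h1
  have h3 : (expDeg I : ℝ) = ∑ i, w i * (expDeg i.2.1 : ℝ) := by
    simp only [expDeg, Nat.cast_sum, ← h.bary, Finset.mul_sum]
    rw [Finset.sum_comm]
  have h4 : expDeg (I - i0.2.1) + expDeg i0.2.1 = expDeg I := by
    simp only [expDeg]
    rw [← Finset.sum_add_distrib]
    exact Finset.sum_congr rfl (fun t _ => Nat.sub_add_cancel (hle t))
  have h2 : ∑ i, w i * ((mpD F i.1.1 : ℝ) - (expDeg i.2.1 : ℝ)) ≥
      (mpD F i0.1.1 : ℝ) - (expDeg i0.2.1 : ℝ) := by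
    have hnn : ∀ i : MPAtom F, 0 ≤ (mpD F i.1.1 : ℝ) - (expDeg i.2.1 : ℝ) := fun i =>
      sub_nonneg.2 (by exact_mod_cast mpP_deg F i)
    have := Finset.single_le_sum
      (f := fun i : MPAtom F => w i * ((mpD F i.1.1 : ℝ) - (expDeg i.2.1 : ℝ)))
      (s := Finset.univ) (fun i _ => mul_nonneg (h.nonneg i) (hnn i)) (Finset.mem_univ i0)
    refine le_trans ?_ this
    exact le_mul_of_one_le_left (hnn i0) h1
  simp only [mul_sub, Finset.sum_sub_distrib] at h2
  rw [mp_blk_sum (fun i : MPAtom F => i.1.1) w (fun j => (mpD F j : ℝ)), ← h3] at h2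
  simp only [h.mass] at h2
  rw [← Finset.sum_mul] at h2
  have h5 : (expDeg (I - i0.2.1) : ℝ) + expDeg i0.2.1 = expDeg I := by exact_mod_cast h4
  have : ((expDeg (I - i0.2.1) + mpD F i0.1.1 : ℕ) : ℝ) ≤ (((n + 2) * ∑ j, mpD F j : ℕ) : ℝ) := by
    push_cast
    linarith
  exact_mod_cast this

theorem mp_step {n k : ℕ} (F : Fin k → TropPoly n × TropPoly n)
    (hroot : ¬ ∃ a : Fin n → ℝ, ∀ j : Fin k, (F j).1.eval a = (F j).2.eval a)
    (I : Exp n) (w : MPAtom F → ℝ) (hw : MPOpt F I w) :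
    ∃ (j : Fin k) (b : Bool) (m : Exp n), m ∈ (mpP F (j, !b)).supp ∧ m ≤ I ∧
      expDeg (I - m) + mpD F j ≤ (n + 2) * ∑ j, mpD F j ∧
      ∀ m' ∈ (mpP F (j, b)).supp, ∃ w', MPFeas F (I - m + m') w' ∧
        mpCost F w' = mpCost F w - (mpP F (j, !b)).coeff m + (mpP F (j, b)).coeff m' ∧
        (mpMixed F w).card + 1 ≤ (mpMixed F w').card := by
  obtain ⟨hf, hmin⟩ := hw
  obtain ⟨x, μ, hx⟩ := mp_lp_dual (fun i : MPAtom F => i.1.1)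
    (fun i t => (i.2.1 t : ℝ)) (fun i => (mpP F i.1).coeff i.2.1) w hf.nonneg (by
      intro w' h0 h1 h2
      exact hmin w' ⟨h0, fun j => (h1 j).trans (hf.mass j), fun t => (h2 t).trans (hf.bary t)⟩)
  have hx1 : ∀ i : MPAtom F, μ i.1.1 ≤ (mpP F i.1).mono i.2.1 x := fun i => (hx i).1
  have hx2 : ∀ i : MPAtom F, 0 < w i → (mpP F i.1).mono i.2.1 x = μ i.1.1 := fun i => (hx i).2
  have hcost : ∀ w', MPFeas F I w' → (∀ i, 0 < w' i → 0 < w i) → mpCost F w' = mpCost F w := by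
    have key : ∀ w', MPFeas F I w' → (∀ i, 0 < w' i → 0 < w i) → mpCost F w' =
        ∑ j, μ j * ((n:ℝ) + 2) - ∑ t, (I t : ℝ) * x t := by
      intro w' h1 h2
      have e1 : mpCost F w' = ∑ i, w' i * μ i.1.1 - ∑ i, w' i * ∑ t, (i.2.1 t : ℝ) * x t := by
        unfold mpCost
        rw [← Finset.sum_sub_distrib]
        apply Finset.sum_congr rfl
        intro i _
        rcases (h1.nonneg i).eq_or_lt with h0 | h0
        · simp [← h0]
        · have := hx2 i (h2 i h0)
          unfold TropPoly.mono at this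
          rw [← this]; ring
      rw [e1, mp_blk_sum (fun i : MPAtom F => i.1.1) w' μ]
      simp only [h1.mass]
      congr 1
      simp only [← h1.bary, Finset.sum_mul, Finset.mul_sum]
      rw [Finset.sum_comm]
      exact Finset.sum_congr rfl (fun t _ => Finset.sum_congr rfl (fun i _ => by ring))
    intro w' h1 h2
    rw [key w' h1 h2, key w hf (fun i h => h)]
  have hj : ∃ j, (F j).1.eval x ≠ (F j).2.eval x := by
    by_contra hcon
    push Not at hcon
    exact hroot ⟨x, hcon⟩
  obtain ⟨j, hj⟩ := hj
  have hb : ∃ b : Bool, (mpP F (j, !b)).eval x < (mpP F (j, b)).eval x := by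
    rcases lt_or_gt_of_ne hj with h | h
    · exact ⟨true, by simpa [mpP] using h⟩
    · exact ⟨false, by simpa [mpP] using h⟩
  obtain ⟨b, hb⟩ := hb
  have hside : ∀ i : MPAtom F, i.1.1 = j → 0 < w i → i.1.2 = !b := by
    rintro ⟨⟨j', b'⟩, v, hv⟩ hij hpos
    simp only at hij
    subst hij
    by_contra hne
    have hbb : b' = b := by
      cases b <;> cases b' <;> simp at hne ⊢
    subst hbb
    obtain ⟨u, hu, hu2⟩ := Finset.exists_mem_eq_inf' (mpP F (j', !b')).supp_nonempty
      (fun I => (mpP F (j', !b')).mono I x)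
    have h1 := hx1 ⟨(j', !b'), u, hu⟩
    have h2 := hx2 _ hpos
    have h3 : (mpP F (j', b')).eval x ≤ (mpP F (j', b')).mono v x := Finset.inf'_le _ hv
    have h4 : (mpP F (j', !b')).eval x = (mpP F (j', !b')).mono u x := hu2
    simp only at h1 h2
    linarith
  have hjmix : j ∉ mpMixed F w := by
    intro hmem
    obtain ⟨i, hi, hi2⟩ := (Finset.mem_filter.1 hmem).2 b
    have := hside i (by rw [hi2]) hi
    rw [hi2] at this
    cases b <;> simp at this
  -- Caratheodory in block `j`
  have hblk : ∀ a : MPAtom F → ℝ, ∑ i : {i : MPAtom F // i.1.1 = j}, a i.1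
      = ∑ i, if i.1.1 = j then a i else 0 := by
    intro a
    rw [← Finset.sum_filter]
    exact (Finset.sum_subtype (Finset.univ.filter (fun i : MPAtom F => i.1.1 = j))
      (by simp) a).symm
  obtain ⟨u, hu0, hu1, hu2, hu3, ⟨⟨i0, hi0j⟩, hi0⟩⟩ :=
    mp_carath (fun (i : {i : MPAtom F // i.1.1 = j}) t => (i.1.2.1 t : ℝ)) (fun i => w i.1)
      (fun i => hf.nonneg _) (by rw [hblk, hf.mass])
  let w1 : MPAtom F → ℝ := fun i => if hi : i.1.1 = j then u ⟨i, hi⟩ else w i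
  have hw1j : ∀ i : {i : MPAtom F // i.1.1 = j}, w1 i.1 = u i := by
    intro i; simp only [w1, dif_pos i.2]
  have hw1n : ∀ i : MPAtom F, i.1.1 ≠ j → w1 i = w i := by
    intro i hi; simp only [w1, dif_neg hi]
  have hw1pos : ∀ i, 0 < w1 i → 0 < w i := by
    intro i hi
    by_cases h : i.1.1 = j
    · have := hw1j ⟨i, h⟩
      simp only at this
      rw [this] at hi
      exact hu1 _ hi
    · rwa [hw1n i h] at hi
  have hf1 : MPFeas F I w1 := by
    refine ⟨?_, ?_, ?_⟩
    · intro i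
      by_cases h : i.1.1 = j
      · have := hw1j ⟨i, h⟩
        simp only at this
        rw [this]
        exact hu0 _
      · rw [hw1n i h]; exact hf.nonneg i
    · intro j'
      by_cases hjj : j' = j
      · subst hjj
        rw [← hblk]
        simp only [hw1j]
        exact hu2
      · rw [← hf.mass j']
        apply Finset.sum_congr rfl
        intro i _
        split_ifs with h
        · exact hw1n i (by rw [h]; exact hjj)
        · rfl
    · intro t
      rw [← hf.bary t]
      have e : ∀ v : MPAtom F → ℝ, ∑ i, v i * (i.2.1 t : ℝ) =
          ∑ i, (if i.1.1 = j then v i * (i.2.1 t : ℝ) else 0) +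
          ∑ i, (if i.1.1 = j then 0 else v i * (i.2.1 t : ℝ)) := by
        intro v
        rw [← Finset.sum_add_distrib]
        exact Finset.sum_congr rfl (fun i _ => by split_ifs <;> simp)
      rw [e w1, e w]
      congr 1
      · rw [← hblk (fun i => w1 i * (i.2.1 t : ℝ)), ← hblk (fun i => w i * (i.2.1 t : ℝ))]
        simp only [hw1j]
        exact hu3 t
      · apply Finset.sum_congr rfl
        intro i _
        split_ifs with h
        · rfl
        · rw [hw1n i h]
  have hi0' : 1 ≤ w1 i0 := by
    have := hw1j ⟨i0, hi0j⟩
    simp only at this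
    rw [this]; exact hi0
  have hi0s := hside i0 hi0j (hw1pos i0 (by linarith))
  have hc1 := hcost w1 hf1 hw1pos
  clear hi0
  obtain ⟨⟨j', b'⟩, m, hm⟩ := i0
  simp only at hi0j hi0s
  subst hi0j hi0s
  refine ⟨j', b, m, hm, mp_le_of_one_le F I w1 hf1 _ hi0', mp_move_deg F I w1 hf1 _ hi0', ?_⟩
  intro m' hm'
  have hfm := mpMove_feas F I w1 hf1 ⟨(j', !b), m, hm⟩ ⟨(j', b), m', hm'⟩ hi0' rfl
  refine ⟨mpMove F w1 ⟨(j', !b), m, hm⟩ ⟨(j', b), m', hm'⟩, hfm, ?_, ?_⟩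
  · rw [← hc1]
    exact mpMove_sum F w1 _ _ (fun i => (mpP F i.1).coeff i.2.1)
  · rw [← Finset.card_insert_of_notMem hjmix]
    have hne : (⟨(j', b), m', hm'⟩ : MPAtom F) ≠ ⟨(j', !b), m, hm⟩ := by
      intro h
      have := congrArg (fun i : MPAtom F => i.1.2) h
      cases b <;> simp at this
    apply Finset.card_le_card
    intro l hl
    rw [Finset.mem_insert] at hl
    refine Finset.mem_filter.2 ⟨Finset.mem_univ _, ?_⟩
    by_cases hlj : l = j'
    · subst hlj
      have hone : mpMove F w1 ⟨(l, !b), m, hm⟩ ⟨(l, b), m', hm'⟩ ⟨(l, b), m', hm'⟩ = 1 := by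
        have : w1 ⟨(l, b), m', hm'⟩ = 0 := by
          refine le_antisymm ?_ (hf1.nonneg _)
          by_contra hcon
          push Not at hcon
          have := hside _ rfl (hw1pos _ hcon)
          cases b <;> simp at this
        unfold mpMove
        rw [this, if_neg hne, if_pos rfl]
        norm_num
      intro c
      by_cases hcb : c = b
      · exact ⟨⟨(l, b), m', hm'⟩, by rw [hone]; norm_num, by rw [hcb]⟩
      · by_contra hcon
        push Not at hcon
        have hz : ∀ i : MPAtom F, i ≠ ⟨(l, b), m', hm'⟩ →
            (if i.1.1 = l then mpMove F w1 ⟨(l, !b), m, hm⟩ ⟨(l, b), m', hm'⟩ i else 0) = 0 := by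
          intro i hi
          split_ifs with hil
          · refine le_antisymm ?_ (hfm.nonneg i)
            by_contra hpos
            push Not at hpos
            refine hcon i hpos ?_
            have hp1 : 0 < w1 i := by
              unfold mpMove at hpos
              rw [if_neg hi] at hpos
              split_ifs at hpos <;> linarith
            have := hside i hil (hw1pos i hp1)
            refine Prod.ext hil ?_
            rw [this]
            cases b <;> cases c <;> simp at hcb ⊢
          · rfl
        have hmass := hfm.mass l
        rw [Finset.sum_eq_single (⟨(l, b), m', hm'⟩ : MPAtom F) (fun i _ hi => hz i hi)
          (by simp)] at hmass
        rw [if_pos rfl, hone] at hmass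
        have : (0:ℝ) ≤ n := Nat.cast_nonneg n
        linarith
    · have hl' : l ∈ mpMixed F w := hl.resolve_left hlj
      intro c
      obtain ⟨i, hi, hi2⟩ := (Finset.mem_filter.1 hl').2 c
      refine ⟨i, ?_, hi2⟩
      have hne0 : i.1.1 ≠ j' := by rw [hi2]; exact hlj
      unfold mpMove
      rw [if_neg (fun h => hne0 (by rw [h])), if_neg (fun h => hne0 (by rw [h])), hw1n i hne0]
      simpa using hi

theorem mp_easy {n k : ℕ} (F : Fin k → TropPoly n × TropPoly n) (a : Fin n → ℝ)
    (ha : ∀ j : Fin k, (F j).1.eval a = (F j).2.eval a) (comb : MPComb n k) (N : ℕ)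
    (hdeg : comb.DegLE F N)
    (h : ∀ I : Exp n, expDeg I ≤ N →
          (comb.fCoeff F I = ⊤ ∧ comb.gCoeff F I = ⊤) ∨
          (comb.gCoeff F I ≠ ⊤ ∧ comb.gCoeff F I < comb.fCoeff F I)) : False := by
  have hpq : ∀ l, (comb.p F l).eval a = (comb.q F l).eval a := by
    intro l
    unfold MPComb.p MPComb.q
    split_ifs
    · exact (ha _).symm
    · exact ha _
  have : Nonempty (Fin comb.K) := ⟨⟨0, comb.K_pos⟩⟩
  obtain ⟨l0, hl0⟩ := Finite.exists_min
    (fun l => comb.c l + ∑ t, (comb.J l t : ℝ) * a t + (comb.p F l).eval a)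
  obtain ⟨m, hm, hm2⟩ := Finset.exists_mem_eq_inf' (comb.p F l0).supp_nonempty
      (fun I => (comb.p F l0).mono I a)
  have hm3 : (comb.p F l0).eval a = (comb.p F l0).mono m a := hm2
  have hmd : expDeg (comb.J l0 + m) ≤ N := by
    have h1 : expDeg m ≤ (comb.p F l0).deg := Finset.le_sup (f := expDeg) hm
    have h2 : (comb.p F l0).deg ≤ max (F (comb.idx l0)).1.deg (F (comb.idx l0)).2.deg := by
      unfold MPComb.p
      split_ifs <;> simp
    have h3 := hdeg l0
    have h4 : expDeg (comb.J l0 + m) = expDeg (comb.J l0) + expDeg m := by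
      simp [expDeg, Finset.sum_add_distrib]
    omega
  have hfle : comb.fCoeff F (comb.J l0 + m) ≤ ((comb.c l0 + (comb.p F l0).coeff m : ℝ) : WithTop ℝ) := by
    refine (Finset.inf_le (Finset.mem_univ l0)).trans ?_
    have : shiftCoeff (comb.p F l0) (comb.J l0) (comb.J l0 + m) = ((comb.p F l0).coeff m : ℝ) := by
      unfold shiftCoeff
      have e : comb.J l0 + m - comb.J l0 = m := by
        ext t; simp
      rw [e, if_pos ⟨le_self_add, hm⟩]
    rw [this]
    exact le_of_eq (by push_cast; rfl)
  rcases h _ hmd with ⟨h1, _⟩ | ⟨_, h1⟩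
  · rw [h1] at hfle
    simp at hfle
  · have h2 := h1.trans_le hfle
    unfold MPComb.gCoeff at h2
    rw [Finset.inf_lt_iff] at h2
    · obtain ⟨l, _, hl⟩ := h2
      unfold shiftCoeff at hl
      split_ifs at hl with hc
      · rw [← WithTop.coe_add, WithTop.coe_lt_coe] at hl
        obtain ⟨hJ, hs⟩ := hc
        have h3 : (comb.q F l).eval a ≤ (comb.q F l).mono _ a := Finset.inf'_le _ hs
        have h4 := hl0 l
        rw [hpq l, hm3] at h4
        unfold TropPoly.mono at h3 h4
        have h5 : ∑ t, ((comb.J l0 + m - comb.J l) t : ℝ) * a t =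
            ∑ t, (comb.J l0 t : ℝ) * a t + ∑ t, (m t : ℝ) * a t - ∑ t, (comb.J l t : ℝ) * a t := by
          rw [← Finset.sum_add_distrib, ← Finset.sum_sub_distrib]
          apply Finset.sum_congr rfl
          intro t _
          have := hJ t
          simp only [Pi.sub_apply]
          rw [Nat.cast_sub this]
          simp only [Pi.add_apply]
          push_cast
          ring
        rw [h5] at h3
        linarith
      · simp at hl

theorem mp_hard {n k : ℕ} (F : Fin k → TropPoly n × TropPoly n)
    (hroot : ¬ ∃ a : Fin n → ℝ, ∀ j : Fin k, (F j).1.eval a = (F j).2.eval a) :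
    ∃ comb : MPComb n k,
        comb.DegLE F ((n + 2) * ∑ j, mpD F j) ∧
        ∀ I : Exp n, (comb.fCoeff F I = ⊤ ∧ comb.gCoeff F I = ⊤) ∨
          (comb.gCoeff F I ≠ ⊤ ∧ comb.gCoeff F I < comb.fCoeff F I) := by
  let E : Set (Exp n) := {I | ∃ w, MPFeas F I w}
  have hfin : E.Finite := by
    refine (Set.finite_Iic (fun _ : Fin n => (n + 2) * ∑ j, mpD F j)).subset ?_
    rintro I ⟨w, hw⟩ t
    refine le_trans ?_ (mp_feas_deg F I w hw)
    exact Finset.single_le_sum (f := I) (fun _ _ => Nat.zero_le _) (Finset.mem_univ t)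
  have hne : E.Nonempty := by
    let v : Fin k → MPAtom F := fun j => ⟨(j, true), _, (mpP F (j, true)).supp_nonempty.choose_spec⟩
    have hs : ∀ a : MPAtom F → ℝ, ∑ i, (∑ j, if v j = i then (n:ℝ) + 2 else 0) * a i
        = ∑ j, ((n:ℝ) + 2) * a (v j) := by
      intro a
      simp only [Finset.sum_mul]
      rw [Finset.sum_comm]
      exact Finset.sum_congr rfl (fun j _ => by simp)
    refine ⟨fun t => ∑ j, (n + 2) * (v j).2.1 t,
      fun i => ∑ j, if v j = i then (n:ℝ) + 2 else 0, ?_, ?_, ?_⟩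
    · intro i
      refine Finset.sum_nonneg (fun j _ => ?_)
      split_ifs <;> positivity
    · intro j
      have := hs (fun i => if i.1.1 = j then 1 else 0)
      simp only [mul_ite, mul_one, mul_zero] at this
      rw [this]
      simp [v]
    · intro t
      rw [hs (fun i => (i.2.1 t : ℝ))]
      push_cast
      rfl
  -- best optimal weights
  have hbest : ∀ I : E, ∃ w, MPOpt F I.1 w ∧
      ∀ w', MPOpt F I.1 w' → (mpMixed F w').card ≤ (mpMixed F w).card := by
    intro I
    let S : Set ℕ := {r | ∃ w, MPOpt F I.1 w ∧ (mpMixed F w).card = r}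
    have hS : S.Nonempty := by
      obtain ⟨w, hw⟩ := mp_exists_opt F I.1 I.2
      exact ⟨_, w, hw, rfl⟩
    have hbdd : BddAbove S := by
      refine ⟨k, ?_⟩
      rintro r ⟨w, _, rfl⟩
      simpa using Finset.card_le_univ (mpMixed F w)
    obtain ⟨w, hw, hr⟩ := Nat.sSup_mem hS hbdd
    refine ⟨w, hw, fun w' hw' => ?_⟩
    rw [hr]
    exact le_csSup hbdd ⟨w', hw', rfl⟩
  choose W hW hWmax using hbest
  choose j b m hm hmle hmdeg hstep using fun I : E => mp_step F hroot I.1 (W I) (hW I)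
  have hstep2 : ∀ I I' : E, ∀ m' ∈ (mpP F (j I, b I)).supp, I'.1 = I.1 - m I + m' →
      ∀ᶠ ε in nhdsWithin (0:ℝ) (Set.Ioi 0),
        mpCost F (W I') - ε * (mpMixed F (W I')).card <
        mpCost F (W I) - ε * (mpMixed F (W I)).card - (mpP F (j I, !b I)).coeff (m I)
          + (mpP F (j I, b I)).coeff m' := by
    intro I I' m' hm' hI'
    obtain ⟨w', h1, h2, h3⟩ := hstep I m' hm'
    rw [← hI'] at h1
    have hle := (hW I').2 w' h1
    rcases hle.lt_or_eq with hlt | heq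
    · have ht : Filter.Tendsto (fun ε : ℝ => (mpCost F (W I) - ε * (mpMixed F (W I)).card
          - (mpP F (j I, !b I)).coeff (m I) + (mpP F (j I, b I)).coeff m')
          - (mpCost F (W I') - ε * (mpMixed F (W I')).card)) (nhdsWithin (0:ℝ) (Set.Ioi 0))
          (nhds ((mpCost F (W I) - 0 * (mpMixed F (W I)).card
          - (mpP F (j I, !b I)).coeff (m I) + (mpP F (j I, b I)).coeff m')
          - (mpCost F (W I') - 0 * (mpMixed F (W I')).card))) := by
        apply Filter.Tendsto.mono_left _ nhdsWithin_le_nhds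
        apply Continuous.tendsto (f := fun ε : ℝ => (mpCost F (W I) - ε * (mpMixed F (W I)).card
          - (mpP F (j I, !b I)).coeff (m I) + (mpP F (j I, b I)).coeff m')
          - (mpCost F (W I') - ε * (mpMixed F (W I')).card))
        fun_prop
      filter_upwards [ht.eventually (lt_mem_nhds (show (0:ℝ) < _ by linarith))] with ε hε
      linarith
    · have hopt : MPOpt F I'.1 w' := ⟨h1, fun w'' hw'' => by rw [← heq]; exact (hW I').2 w'' hw''⟩
      have h4 := h3.trans (hWmax I' w' hopt)
      have h5 : ((mpMixed F (W I)).card : ℝ) + 1 ≤ (mpMixed F (W I')).card := by exact_mod_cast h4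
      filter_upwards [self_mem_nhdsWithin] with ε hε
      have hε' : (0:ℝ) < ε := hε
      have h6 := mul_le_mul_of_nonneg_left h5 hε'.le
      rw [mul_add] at h6
      linarith
  have : Finite E := hfin
  have hall : ∀ᶠ ε in nhdsWithin (0:ℝ) (Set.Ioi 0), ∀ I I' : E,
      ∀ m' : {m' // m' ∈ (mpP F (j I, b I)).supp}, I'.1 = I.1 - m I + m'.1 →
        mpCost F (W I') - ε * (mpMixed F (W I')).card <
        mpCost F (W I) - ε * (mpMixed F (W I)).card - (mpP F (j I, !b I)).coeff (m I)
          + (mpP F (j I, b I)).coeff m'.1 := by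
    refine Filter.eventually_all.2 (fun I => Filter.eventually_all.2 (fun I' =>
      Filter.eventually_all.2 (fun m' => ?_)))
    by_cases h : I'.1 = I.1 - m I + m'.1
    · filter_upwards [hstep2 I I' m'.1 m'.2 h] with ε hε _
      exact hε
    · exact Filter.Eventually.of_forall (fun ε h' => absurd h' h)
  obtain ⟨ε, hε⟩ := hall.exists
  have := Fintype.ofFinite E
  have : Nonempty E := hne.to_subtype
  let e := (Fintype.equivFin E).symm
  let comb : MPComb n k :=
    { K := Fintype.card E
      K_pos := Fintype.card_pos
      c := fun l => mpCost F (W (e l)) - ε * (mpMixed F (W (e l))).card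
        - (mpP F (j (e l), !b (e l))).coeff (m (e l))
      J := fun l => (e l).1 - m (e l)
      idx := fun l => j (e l)
      flip := fun l => b (e l) }
  have hp : ∀ l, comb.p F l = mpP F (j (e l), b (e l)) := fun l => rfl
  have hq : ∀ l, comb.q F l = mpP F (j (e l), !b (e l)) := by
    intro l
    simp only [MPComb.q, mpP, comb]
    cases b (e l) <;> simp
  have hE : ∀ (l : Fin comb.K) (I : Exp n), comb.J l ≤ I → I - comb.J l ∈ (comb.p F l).supp →
      ∃ h : I ∈ E, mpCost F (W ⟨I, h⟩) - ε * (mpMixed F (W ⟨I, h⟩)).card <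
        comb.c l + (comb.p F l).coeff (I - comb.J l) := by
    intro l I hJ hs
    obtain ⟨w', h1, _, _⟩ := hstep (e l) (I - comb.J l) hs
    have hI : (e l).1 - m (e l) + (I - comb.J l) = I := by
      ext t
      exact Nat.add_sub_cancel' (hJ t)
    rw [hI] at h1
    exact ⟨⟨w', h1⟩, hε (e l) ⟨I, _⟩ ⟨I - comb.J l, hs⟩ hI.symm⟩
  refine ⟨comb, fun l => hmdeg (e l), ?_⟩
  intro I
  by_cases hI : I ∈ E
  · right
    have hg : comb.gCoeff F I ≤
        ((mpCost F (W ⟨I, hI⟩) - ε * (mpMixed F (W ⟨I, hI⟩)).card : ℝ) : WithTop ℝ) := by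
      refine (Finset.inf_le (Finset.mem_univ (e.symm ⟨I, hI⟩))).trans ?_
      have h1 : e (e.symm ⟨I, hI⟩) = ⟨I, hI⟩ := by simp
      have h2 : shiftCoeff (comb.q F (e.symm ⟨I, hI⟩)) (comb.J (e.symm ⟨I, hI⟩)) I =
          (((mpP F (j ⟨I, hI⟩, !b ⟨I, hI⟩)).coeff (m ⟨I, hI⟩) : ℝ) : WithTop ℝ) := by
        rw [hq]
        simp only [comb]
        rw [h1]
        have h3 : I - (I - m ⟨I, hI⟩) = m ⟨I, hI⟩ := by
          ext t
          exact Nat.sub_sub_self (hmle ⟨I, hI⟩ t)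
        unfold shiftCoeff
        simp only
        rw [h3, if_pos ⟨tsub_le_self, hm ⟨I, hI⟩⟩]
      rw [h2]
      simp only [comb]
      rw [h1, ← WithTop.coe_add]
      exact le_of_eq (by congr 1; ring)
    have hg2 := hg.trans_lt (WithTop.coe_lt_top _)
    refine ⟨hg2.ne, ?_⟩
    unfold MPComb.fCoeff
    rw [Finset.lt_inf_iff hg2]
    intro l _
    unfold shiftCoeff
    split_ifs with hc
    · obtain ⟨_, h2⟩ := hE l I hc.1 hc.2
      refine hg.trans_lt ?_
      rw [← WithTop.coe_add, WithTop.coe_lt_coe]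
      exact h2
    · simpa using hg2
  · have hftop : comb.fCoeff F I = ⊤ := by
      unfold MPComb.fCoeff
      rw [Finset.inf_eq_top_iff]
      intro l _
      unfold shiftCoeff
      rw [if_neg, WithTop.add_top]
      rintro ⟨h1, h2⟩
      exact hI (hE l I h1 h2).1
    by_cases hg : comb.gCoeff F I = ⊤
    · exact Or.inl ⟨hftop, hg⟩
    · exact Or.inr ⟨hg, by rw [hftop]; exact lt_top_iff_ne_top.2 hg⟩

/-- **Min-plus primary Nullstellensatz over ℝ** : a system `F` of min-plus polynomials in
`n` variables over `ℝ` has no root iff there is a min-plus algebraic combination `(f,g)`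
of `F` of degree at most `N = (n+2)(d_1 + ⋯ + d_k)` such that for every exponent vector
`I` with `|I| ≤ N` either `f_I = g_I = +∞`, or `g_I` is finite and `g_I < f_I`. -/
theorem minplus_primary_nullstellensatz_real (n k : ℕ) (hk : 1 ≤ k)
    (F : Fin k → TropPoly n × TropPoly n) :
    (¬ ∃ a : Fin n → ℝ, ∀ j : Fin k, (F j).1.eval a = (F j).2.eval a) ↔
      ∃ comb : MPComb n k,
        comb.DegLE F ((n + 2) * ∑ j, max (F j).1.deg (F j).2.deg) ∧
        ∀ I : Exp n, expDeg I ≤ (n + 2) * ∑ j, max (F j).1.deg (F j).2.deg →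
          (comb.fCoeff F I = ⊤ ∧ comb.gCoeff F I = ⊤) ∨
          (comb.gCoeff F I ≠ ⊤ ∧ comb.gCoeff F I < comb.fCoeff F I) := by
  constructor
  · intro h
    obtain ⟨comb, h1, h2⟩ := mp_hard F h
    exact ⟨comb, h1, fun I _ => h2 I⟩
  · rintro ⟨comb, h1, h2⟩ ⟨a, ha⟩
    exact mp_easy F a ha comb _ h1 h2
end
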